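/- arXiv:1802.00256 — 2 statements merged into one kernel-verified Lean document; each statement's English description precedes it below -/
import Mathlib

section
/- Let F be a pseudo p-adically closed field whose p-adic valuations are exactly the n pairwise distinct valuations v₁, …, v_n. Let L be a totally p-adic regular field extension of F, and for each i ≤ n let w_i be a p-adic valuation on L extending v_i. Fix a p-adic closure (N_i, ŵ_i) of (L, w_i) and a p-adic closure (M_i, v̂_i) of (F, v_i) with M_i a subfield of N_i and ŵ_i extending v̂_i. Consider a finite system of conditions on a tuple of variables x, each condition being of one of the following forms: P(x) = 0 or Q(x) ≠ 0 for polynomials P, Q with coefficients in F; w_i(R(x)) ≤ w_i(S(x)) for polynomials R, S over F and some i ≤ n; or 'T(x) is a nonzero m-th power in N_i' for a polynomial T over F, some integer m ≥ 1 and some i ≤ n. If this system has a solution with coordinates in L, then the corresponding system — with each w_i replaced by v_i and each N_i replaced by M_i — has a solution with coordinates in F. -/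
universe u

/-- `x` is a nonzero `m`-th power in the field `K`. -/
def IsNonzeroPow {K : Type*} [Field K] (m : ℕ) (x : K) : Prop :=
  x ≠ 0 ∧ ∃ y : K, x = y ^ m

/-- The field extension given by the embedding `f` is algebraic. -/
def AlgebraicExt {F L : Type*} [Field F] [Field L] (f : F →+* L) : Prop :=
  ∀ x : L, ∃ q : Polynomial F, q ≠ 0 ∧ Polynomial.eval₂ f x q = 0

/-- The field extension given by the embedding `f` is regular (characteristic-0 version):
every element of `L` algebraic over (the image of) `F` lies in the image of `F`. -/
def RegularExt {F L : Type*} [Field F] [Field L] (f : F →+* L) : Prop :=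
  ∀ x : L, (∃ q : Polynomial F, q ≠ 0 ∧ Polynomial.eval₂ f x q = 0) → x ∈ f.range

/-- `O` is (the valuation ring of) a `p`-adic valuation on `F`: its residue field has
exactly `p` elements and `v(p)` is the smallest positive element of the value group
(multiplicatively: `v p < 1` and `v x ≤ v p` for every `x ≠ 0` with `v x < 1`). -/
def IsPadicValRing (p : ℕ) {F : Type*} [Field F] (O : ValuationSubring F) : Prop :=
  Nat.card (IsLocalRing.ResidueField O) = p ∧
  O.valuation (p : F) < 1 ∧
  ∀ x : F, x ≠ 0 → O.valuation x < 1 → O.valuation x ≤ O.valuation (p : F)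

/-- `(M, Ohat)` is `p`-adically closed: it is `p`-adically valued and admits no proper
algebraic extension to which the valuation extends as a `p`-adic valuation. -/
def IsPadicallyClosedPair (p : ℕ) {M : Type u} [Field M] (Ohat : ValuationSubring M) : Prop :=
  IsPadicValRing p Ohat ∧
  ∀ (M' : Type u) [Field M'] (g : M →+* M'), AlgebraicExt g →
    ∀ Ohat' : ValuationSubring M', IsPadicValRing p Ohat' → Ohat'.comap g = Ohat →
      Function.Surjective g

/-- `(M, Ohat)` (via the embedding `f`) is a `p`-adic closure of `(F, O)`: an algebraic
extension, with `Ohat` a `p`-adic valuation (ring) extending `O`, which is `p`-adically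
closed. -/
def IsPadicClosure (p : ℕ) {F : Type u} {M : Type u} [Field F] [Field M]
    (f : F →+* M) (O : ValuationSubring F) (Ohat : ValuationSubring M) : Prop :=
  AlgebraicExt f ∧ Ohat.comap f = O ∧ IsPadicallyClosedPair p Ohat

/-- The field extension given by `f` is totally `p`-adic: every `p`-adic valuation of the
base field extends to a `p`-adic valuation of the extension. -/
def TotallyPadicExt (p : ℕ) {F L : Type*} [Field F] [Field L] (f : F →+* L) : Prop :=
  ∀ O : ValuationSubring F, IsPadicValRing p O →
    ∃ O' : ValuationSubring L, IsPadicValRing p O' ∧ O'.comap f = O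

/-- `F` is pseudo `p`-adically closed: it has characteristic `0` and it is existentially
closed (for systems of polynomial equations and inequations) in every totally `p`-adic
regular field extension. -/
def IsPpC (p : ℕ) (F : Type u) [Field F] : Prop :=
  CharZero F ∧
  ∀ (L : Type u) [Field L] (f : F →+* L), TotallyPadicExt p f → RegularExt f →
    ∀ (k : ℕ) (eqs neqs : Finset (MvPolynomial (Fin k) F)),
      (∃ x : Fin k → L,
        (∀ P ∈ eqs, MvPolynomial.eval x (MvPolynomial.map f P) = 0) ∧
        (∀ Q ∈ neqs, MvPolynomial.eval x (MvPolynomial.map f Q) ≠ 0)) →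
      ∃ x : Fin k → F,
        (∀ P ∈ eqs, MvPolynomial.eval x P = 0) ∧
        (∀ Q ∈ neqs, MvPolynomial.eval x Q ≠ 0)

/-- An elementary description of the valuation rings of `p`-adic valuations in
characteristic `0`. -/
structure PadicRing (p : ℕ) {K : Type*} [Field K] (O : ValuationSubring K) : Prop where
  inv_notMem : (p : K)⁻¹ ∉ O
  approx : ∀ x ∈ O, ∃ k : ℤ, (x - k) / p ∈ O

namespace PadicRing

variable {p : ℕ} {K : Type*} [Field K] {O : ValuationSubring K}

theorem ne_zero (h : PadicRing p O) : (p : K) ≠ 0 := fun h0 =>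
  h.inv_notMem (by simp [h0, O.zero_mem])

theorem val_lt_one (h : PadicRing p O) : O.valuation (p : K) < 1 := by
  have := h.inv_notMem
  rw [← O.valuation_le_one_iff, map_inv₀, not_le] at this
  exact (one_lt_inv₀ (by simpa [zero_lt_iff] using h.ne_zero)).1 this

theorem val_lt_one_of_div (h : PadicRing p O) {x : K} (hx : x / p ∈ O) :
    O.valuation x < 1 := by
  have h1 : O.valuation x = O.valuation (x / p) * O.valuation (p : K) := by
    rw [← map_mul, div_mul_cancel₀ _ h.ne_zero]
  rw [h1]
  exact mul_lt_one_of_nonneg_of_lt_one_right ((O.valuation_le_one_iff _).2 hx) zero_le h.val_lt_one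

theorem val_int_le (k : ℤ) : O.valuation (k : K) ≤ 1 :=
  (O.valuation_le_one_iff _).2 (intCast_mem O k)

theorem val_int_lt_one_iff (hp : p.Prime) (h : PadicRing p O) (k : ℤ) :
    O.valuation (k : K) < 1 ↔ (p : ℤ) ∣ k := by
  constructor
  · intro hk
    by_contra hd
    have hc : IsCoprime (p : ℤ) k := (Nat.prime_iff_prime_int.1 hp).coprime_iff_not_dvd.2 hd
    obtain ⟨a, c, hac⟩ := hc
    have h1 : (1 : K) = a * p + c * k := by exact_mod_cast congrArg (Int.cast : ℤ → K) hac.symm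
    have h2 : O.valuation (1 : K) < 1 := by
      rw [h1]
      refine (O.valuation.map_add_lt ?_ ?_)
      · rw [map_mul]; exact mul_lt_one_of_nonneg_of_lt_one_right (val_int_le a) zero_le h.val_lt_one
      · rw [map_mul]; exact mul_lt_one_of_nonneg_of_lt_one_right (val_int_le c) zero_le hk
    simp at h2
  · rintro ⟨c, rfl⟩
    push_cast
    rw [map_mul]
    exact mul_lt_one_of_nonneg_of_lt_one_left zero_le h.val_lt_one (val_int_le c)

theorem div_mem (hp : p.Prime) (h : PadicRing p O) {x : K} (hx : O.valuation x < 1) :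
    x / p ∈ O := by
  obtain ⟨k, hk⟩ := h.approx x ((O.valuation_le_one_iff _).1 hx.le)
  have h1 := h.val_lt_one_of_div hk
  have h2 : O.valuation (k : K) < 1 := by
    have : (k : K) = x - (x - k) := by ring
    rw [this]
    exact O.valuation.map_sub_lt hx h1
  obtain ⟨c, rfl⟩ := (val_int_lt_one_iff hp h k).1 h2
  have : x / p = (x - ((p * c : ℤ) : K)) / p + c := by
    have := h.ne_zero
    push_cast; field_simp; ring
  rw [this]
  exact O.add_mem _ _ hk (intCast_mem O c)

theorem comap {K' : Type*} [Field K'] (g : K →+* K') {O' : ValuationSubring K'}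
    (h : PadicRing p O') : PadicRing p (O'.comap g) where
  inv_notMem := by
    rw [ValuationSubring.mem_comap, map_inv₀, map_natCast]; exact h.inv_notMem
  approx x hx := by
    obtain ⟨k, hk⟩ := h.approx (g x) hx
    exact ⟨k, by simpa [ValuationSubring.mem_comap] using hk⟩

theorem of_isPadicValRing [CharZero K] (hp : p.Prime) (h : IsPadicValRing p O) :
    PadicRing p O := by
  obtain ⟨h1, h2, h3⟩ := h
  have hp0 : (p : K) ≠ 0 := by exact_mod_cast hp.ne_zero
  refine ⟨fun hm => ?_, fun x hx => ?_⟩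
  · rw [← O.valuation_le_one_iff, map_inv₀] at hm
    exact absurd hm (not_le.2 ((one_lt_inv₀ (by simpa [zero_lt_iff] using hp0)).2 h2))
  · have : Fact p.Prime := ⟨hp⟩
    have hfin : Finite (IsLocalRing.ResidueField O) :=
      Nat.finite_of_card_ne_zero (by rw [h1]; exact hp.ne_zero)
    have := Fintype.ofFinite (IsLocalRing.ResidueField O)
    have hc : CharP (IsLocalRing.ResidueField O) p := by
      refine charP_of_card_eq_prime (by rw [← h1, Nat.card_eq_fintype_card])
    have hs : Function.Surjective (ZMod.castHom dvd_rfl (IsLocalRing.ResidueField O) : ZMod p →+* _) := by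
      refine ((Fintype.bijective_iff_injective_and_card _).2 ⟨RingHom.injective _, ?_⟩).2
      rw [ZMod.card, ← Nat.card_eq_fintype_card, h1]
    obtain ⟨z, hz⟩ := hs (IsLocalRing.residue O ⟨x, hx⟩)
    obtain ⟨k, rfl⟩ := ZMod.intCast_surjective z
    refine ⟨k, ?_⟩
    have h4 : IsLocalRing.residue O (⟨x, hx⟩ - (k : O)) = 0 := by
      rw [map_sub, ← hz]; simp
    rw [IsLocalRing.residue_eq_zero_iff, ValuationSubring.valuation_lt_one_iff] at h4
    have h5 : O.valuation (x - k) < 1 := by simpa using h4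
    rw [← O.valuation_le_one_iff, map_div₀]
    by_cases hxk : x - k = 0
    · simp [hxk]
    · exact div_le_one_of_le₀ (h3 _ hxk h5) zero_le

theorem isPadicValRing (hp : p.Prime) (h : PadicRing p O) : IsPadicValRing p O := by
  have : Fact p.Prime := ⟨hp⟩
  refine ⟨?_, h.val_lt_one, fun x _ hx => ?_⟩
  · have hc : CharP (IsLocalRing.ResidueField O) p := by
      rw [CharP.charP_iff_prime_eq_zero hp]
      have h0 : IsLocalRing.residue O (p : O) = 0 := by
        rw [IsLocalRing.residue_eq_zero_iff, ValuationSubring.valuation_lt_one_iff]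
        simpa using h.val_lt_one
      simpa using h0
    have hs : Function.Bijective (ZMod.castHom dvd_rfl (IsLocalRing.ResidueField O) : ZMod p →+* _) := by
      refine ⟨RingHom.injective _, fun z => ?_⟩
      obtain ⟨x, rfl⟩ := IsLocalRing.residue_surjective z
      obtain ⟨k, hk⟩ := h.approx x x.2
      refine ⟨k, ?_⟩
      have h5 := h.val_lt_one_of_div hk
      have h4 : IsLocalRing.residue O (x - (k : O)) = 0 := by
        rw [IsLocalRing.residue_eq_zero_iff, ValuationSubring.valuation_lt_one_iff]
        simpa using h5
      rw [map_sub, sub_eq_zero] at h4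
      rw [h4]; simp
    rw [← Nat.card_congr (Equiv.ofBijective _ hs), Nat.card_zmod]
  · have := div_mem hp h hx
    rw [← O.valuation_le_one_iff, map_div₀] at this
    exact (div_le_one₀ (by simpa [zero_lt_iff] using h.ne_zero)).1 this

end PadicRing

open Polynomial in
/-- The derivative of the minimal polynomial of a primitive element multiplies integral
elements into the order generated by that element. -/
theorem exists_aeval_eq_derivative_minpoly_mul {A K L : Type*} [CommRing A] [IsDomain A]
    [IsIntegrallyClosed A] [Field K] [Field L] [Algebra A K] [IsFractionRing A K]
    [Algebra K L] [Algebra A L] [IsScalarTower A K L] [FiniteDimensional K L]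
    [Algebra.IsSeparable K L] {α : L} (hα : Algebra.adjoin K {α} = ⊤) (hint : IsIntegral A α)
    {b : L} (hb : IsIntegral A b) :
    ∃ P : A[X], aeval α P = aeval α (derivative (minpoly A α)) * b := by
  have h1 : b ∈ (Algebra.traceForm K L).dualSubmodule
      (Subalgebra.toSubmodule (Algebra.adjoin A {α})) := by
    rw [LinearMap.BilinForm.mem_dualSubmodule]
    intro y hy
    have hy' : IsIntegral A y :=
      adjoin_le_integralClosure hint hy
    have h2 : IsIntegral A (Algebra.traceForm K L b y) := by
      rw [Algebra.traceForm_apply]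
      exact Algebra.isIntegral_trace (hb.mul hy')
    obtain ⟨c, hc⟩ := IsIntegrallyClosed.isIntegral_iff.1 h2
    exact Submodule.mem_one.2 ⟨c, hc⟩
  rw [traceForm_dualSubmodule_adjoin A K hα hint] at h1
  obtain ⟨c, hc, hcb⟩ := h1
  rw [SetLike.mem_coe, Subalgebra.mem_toSubmodule, Algebra.adjoin_singleton_eq_range_aeval] at hc
  obtain ⟨P, rfl⟩ := hc
  refine ⟨P, ?_⟩
  have hne : aeval α (derivative (minpoly K α)) ≠ 0 :=
    (Algebra.IsSeparable.isSeparable K α).aeval_derivative_ne_zero (minpoly.aeval K α)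
  have h3 : aeval α (derivative (minpoly K α)) = aeval α (derivative (minpoly A α)) := by
    rw [minpoly.isIntegrallyClosed_eq_field_fractions' K hint, derivative_map, aeval_map_algebraMap]
  rw [← h3, ← hcb]
  simp [hne]

/-- An element of a field extension which lies in every valuation ring containing the base ring
is integral. -/
theorem isIntegral_of_forall_valuationSubring {A L : Type*} [CommRing A] [Field L] [Algebra A L]
    {b : L} (h : ∀ V : ValuationSubring L, (∀ a : A, algebraMap A L a ∈ V) → b ∈ V) :
    IsIntegral A b := by
  by_contra hb
  obtain ⟨V, hV, hbV⟩ := Subring.exists_le_valuationSubring_of_isIntegrallyClosedIn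
    (R := (integralClosure A L).toSubring) (x := b) hb
  exact hbV (h V fun a => hV (algebraMap_mem (integralClosure A L) a))

open Polynomial in
/-- Elements of a valuation ring of an algebraic extension are quotients of integral elements
with unit denominator. -/
theorem exists_integral_mul_integral {K L : Type*} [Field K] [Field L] [Algebra K L]
    {O : ValuationSubring K} {W : ValuationSubring L} [Algebra O L] [IsScalarTower O K L]
    (hW : W.comap (algebraMap K L) = O) {x : L} (hx : x ∈ W) (halg : IsAlgebraic K x) :
    ∃ b c : L, IsIntegral O b ∧ IsIntegral O c ∧ W.valuation b = 1 ∧ b * x = c := by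
  have hlt : ∀ a : K, O.valuation a < 1 → W.valuation (algebraMap K L a) < 1 := by
    intro a ha
    by_cases h0 : a = 0
    · simp [h0]
    have : a⁻¹ ∉ O := by
      rw [← O.valuation_le_one_iff, map_inv₀, not_le]
      exact (one_lt_inv₀ (by simpa [zero_lt_iff] using h0)).2 ha
    rw [← hW, ValuationSubring.mem_comap, map_inv₀, ← W.valuation_le_one_iff, map_inv₀, not_le] at this
    exact (one_lt_inv₀ (by simpa [zero_lt_iff] using h0)).1 this
  have hle : ∀ a : K, O.valuation a ≤ 1 → W.valuation (algebraMap K L a) ≤ 1 := by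
    intro a ha
    rw [W.valuation_le_one_iff, ← ValuationSubring.mem_comap, hW]
    exact (O.valuation_le_one_iff a).1 ha
  by_cases hx0 : x = 0
  · exact ⟨1, 0, isIntegral_one, isIntegral_zero, by simp, by simp [hx0]⟩
  obtain ⟨q, hq0, hq⟩ := halg
  obtain ⟨j, hj, hjmax⟩ := q.support.exists_max_image (fun i => O.valuation (q.coeff i))
    (support_nonempty.2 hq0)
  have hcj : q.coeff j ≠ 0 := mem_support_iff.1 hj
  let c : ℕ → K := fun i => (q.coeff j)⁻¹ * q.coeff i
  have hc1 : ∀ i, O.valuation (c i) ≤ 1 := by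
    intro i
    by_cases hi : q.coeff i = 0
    · simp [c, hi]
    · have := hjmax i (mem_support_iff.2 hi)
      simp only [c, map_mul, map_inv₀]
      rw [inv_mul_le_iff₀ (by simpa [zero_lt_iff] using hcj), mul_one]
      exact this
  have hcx : ∑ i ∈ Finset.range (q.natDegree + 1), algebraMap K L (c i) * x ^ i = 0 := by
    have h1 : aeval x (C (q.coeff j)⁻¹ * q) = 0 := by rw [map_mul, hq, mul_zero]
    rw [map_mul, aeval_C, aeval_eq_sum_range, Finset.mul_sum] at h1
    rw [← h1]
    refine Finset.sum_congr rfl fun i _ => ?_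
    simp only [c, map_mul, Algebra.smul_def, mul_assoc]
  have hjn : j ∈ (Finset.range (q.natDegree + 1)).filter (fun i => O.valuation (c i) = 1) := by
    simp only [Finset.mem_filter, Finset.mem_range]
    exact ⟨Nat.lt_succ_of_le (le_natDegree_of_ne_zero hcj), by simp [c, hcj]⟩
  obtain ⟨k, hk, hkmax⟩ := Finset.exists_max_image _ id ⟨j, hjn⟩
  simp only [Finset.mem_filter, Finset.mem_range, id] at hk hkmax
  obtain ⟨m, hm⟩ := Nat.exists_eq_add_of_lt hk.1
  rw [hm, add_assoc, Finset.sum_range_add] at hcx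
  set b := ∑ i ∈ Finset.range (m + 1), algebraMap K L (c (k + i)) * x ^ i with hb
  set S := ∑ i ∈ Finset.range k, algebraMap K L (c i) * x⁻¹ ^ (k - 1 - i) with hS
  have hbx : b * x = - S := by
    have h1 : b * x ^ k + ∑ i ∈ Finset.range k, algebraMap K L (c i) * x ^ i = 0 := by
      rw [← hcx, add_comm, hb, Finset.sum_mul]
      congr 1
      refine Finset.sum_congr rfl fun i _ => ?_
      rw [mul_assoc, ← pow_add, add_comm i k]
    rcases Nat.eq_zero_or_pos k with rfl | hk0
    · simp only [Finset.range_zero, Finset.sum_empty, pow_zero, mul_one, add_zero] at h1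
      simp [h1, hS]
    · have h2 : ∑ i ∈ Finset.range k, algebraMap K L (c i) * x ^ i = S * x ^ (k - 1) := by
        rw [hS, Finset.sum_mul]
        refine Finset.sum_congr rfl fun i hi => ?_
        rw [Finset.mem_range] at hi
        have h3 : x ^ (k - 1) = x ^ (k - 1 - i) * x ^ i := by
          rw [← pow_add]; congr 1; omega
        rw [h3, inv_pow]
        field_simp
      have h4 : x ^ k = x * x ^ (k - 1) := by
        rw [← pow_succ']; congr 1; omega
      rw [h2, h4] at h1
      have h5 : (b * x + S) * x ^ (k - 1) = 0 := by rw [← h1]; ring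
      have := (mul_eq_zero.1 h5).resolve_right (pow_ne_zero _ hx0)
      exact eq_neg_of_add_eq_zero_left this
  have hcV : ∀ V : ValuationSubring L, (∀ a : O, algebraMap O L a ∈ V) →
      ∀ i, algebraMap K L (c i) ∈ V := fun V hV i =>
    (IsScalarTower.algebraMap_apply O K L ⟨c i, (O.valuation_le_one_iff _).1 (hc1 i)⟩) ▸ hV _
  have hbV : ∀ V : ValuationSubring L, (∀ a : O, algebraMap O L a ∈ V) → b ∈ V ∧ b * x ∈ V := by
    intro V hV
    rcases V.mem_or_inv_mem x with h | h
    · have : b ∈ V := sum_mem fun i _ => mul_mem (hcV V hV _) (pow_mem h i)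
      exact ⟨this, mul_mem this h⟩
    · have h1 : b * x ∈ V := by
        rw [hbx]
        exact neg_mem (sum_mem fun i _ => mul_mem (hcV V hV _) (pow_mem h _))
      refine ⟨?_, h1⟩
      have : b = b * x * x⁻¹ := by field_simp
      rw [this]
      exact mul_mem h1 h
  refine ⟨b, b * x, isIntegral_of_forall_valuationSubring fun V hV => (hbV V hV).1,
    isIntegral_of_forall_valuationSubring fun V hV => (hbV V hV).2, ?_, rfl⟩
  rw [hb, Finset.sum_range_succ']
  have h1 : W.valuation (algebraMap K L (c (k + 0)) * x ^ 0) = 1 := by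
    rw [pow_zero, mul_one, add_zero]
    refine le_antisymm (hle _ (hc1 k)) ?_
    by_contra hlt1
    rw [not_le] at hlt1
    have hck : c k ≠ 0 := by
      intro h; rw [h] at hk; simp at hk
    have h2 := hle (c k)⁻¹ (by rw [map_inv₀, hk.2, inv_one])
    rw [map_inv₀, map_inv₀] at h2
    exact absurd h2 (not_le.2 ((one_lt_inv₀ (by simpa [zero_lt_iff] using hck)).2 hlt1))
  have h2 : W.valuation (∑ i ∈ Finset.range m, algebraMap K L (c (k + (i + 1))) * x ^ (i + 1)) < 1 := by
    refine W.valuation.map_sum_lt one_ne_zero fun i hi => ?_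
    rw [map_mul, map_pow]
    refine mul_lt_one_of_nonneg_of_lt_one_left zero_le (hlt _ (lt_of_le_of_ne (hc1 _) fun h => ?_))
      (pow_le_one₀ zero_le ((W.valuation_le_one_iff x).2 hx))
    have := hkmax _ ⟨?_, h⟩
    · omega
    · rw [Finset.mem_range] at hi; omega
  rw [← h1] at h2
  rw [W.valuation.map_add_eq_of_lt_right h2, h1]

/-- A valuation ring of a field extends to every field extension. -/
theorem exists_comap_eq {K L : Type*} [Field K] [Field L] (g : K →+* L)
    (O : ValuationSubring K) : ∃ V : ValuationSubring L, V.comap g = O := by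
  obtain ⟨V, hV, hloc⟩ := IsLocalRing.exists_factor_valuationRing (g.comp O.subtype)
  refine ⟨V, ?_⟩
  ext x
  rw [ValuationSubring.mem_comap]
  refine ⟨fun hx => ?_, fun hx => hV ⟨x, hx⟩⟩
  by_contra hxO
  have hx' : x⁻¹ ∈ O := (O.mem_or_inv_mem x).resolve_left hxO
  have hx0 : x ≠ 0 := by rintro rfl; exact hxO O.zero_mem
  have hu : IsUnit ((⟨x⁻¹, hx'⟩ : O)) := by
    refine hloc.map_nonunit _ ?_
    refine IsUnit.of_mul_eq_one ⟨g x, hx⟩ ?_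
    ext
    change g x⁻¹ * g x = 1
    rw [← map_mul, inv_mul_cancel₀ hx0, map_one]
  obtain ⟨y, hy⟩ := hu.exists_left_inv
  have hy' : (y : K) * x⁻¹ = 1 := congrArg Subtype.val hy
  have : (y : K) = x := by
    field_simp at hy'
    exact hy'
  exact hxO (this ▸ y.2)

theorem ValuationSubring.valuation_map_lt_one_iff {K L : Type*} [Field K] [Field L]
    {g : K →+* L} {O : ValuationSubring K} {V : ValuationSubring L} (h : V.comap g = O) (x : K) :
    V.valuation (g x) < 1 ↔ O.valuation x < 1 := by
  by_cases h0 : x = 0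
  · simp [h0]
  have hg0 : g x ≠ 0 := by simpa using h0
  rw [← one_lt_inv₀ (by simpa [zero_lt_iff] using hg0),
    ← one_lt_inv₀ (by simpa [zero_lt_iff] using h0), ← map_inv₀, ← map_inv₀, ← map_inv₀,
    ← not_le, ← not_le, V.valuation_le_one_iff, O.valuation_le_one_iff, ← h,
    ValuationSubring.mem_comap]

theorem ValuationSubring.valuation_map_le_one_iff {K L : Type*} [Field K] [Field L]
    {g : K →+* L} {O : ValuationSubring K} {V : ValuationSubring L} (h : V.comap g = O) (x : K) :
    V.valuation (g x) ≤ 1 ↔ O.valuation x ≤ 1 := by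
  rw [V.valuation_le_one_iff, O.valuation_le_one_iff, ← h, ValuationSubring.mem_comap]

theorem ValuationSubring.valuation_map_eq_one_iff {K L : Type*} [Field K] [Field L]
    {g : K →+* L} {O : ValuationSubring K} {V : ValuationSubring L} (h : V.comap g = O) (x : K) :
    V.valuation (g x) = 1 ↔ O.valuation x = 1 := by
  have h1 := ValuationSubring.valuation_map_lt_one_iff h x
  have h2 := ValuationSubring.valuation_map_le_one_iff h x
  rw [le_antisymm_iff, le_antisymm_iff, h2]
  refine and_congr_right fun _ => ?_
  rw [← not_lt, ← not_lt, h1]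

theorem ValuationSubring.map_coe_mem {K L : Type*} [Field K] [Field L] {g : K →+* L}
    {O : ValuationSubring K} {V : ValuationSubring L} (h : V.comap g = O) (a : O) :
    (g.comp O.subtype) a ∈ V := by
  have : (a : K) ∈ V.comap g := by rw [h]; exact a.2
  exact this

/-- The map induced on valuation rings by a valued field extension. -/
def ValuationSubring.mapOfComap {K L : Type*} [Field K] [Field L] {g : K →+* L}
    {O : ValuationSubring K} {V : ValuationSubring L} (h : V.comap g = O) : O →+* V :=
  (g.comp O.subtype).codRestrict V (ValuationSubring.map_coe_mem h)

open Polynomial in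
theorem ValuationSubring.coe_eval_map {K L : Type*} [Field K] [Field L] {g : K →+* L}
    {O : ValuationSubring K} {V : ValuationSubring L} (h : V.comap g = O) (P : O[X]) (w : V) :
    ((eval w (P.map (mapOfComap h)) : V) : L) = eval₂ (g.comp O.subtype) (w : L) P := by
  rw [eval_map]
  exact hom_eval₂ P (mapOfComap h) V.subtype w

open Polynomial in
theorem ValuationSubring.eval₂_mem {K L : Type*} [Field K] [Field L] {g : K →+* L}
    {O : ValuationSubring K} {V : ValuationSubring L} (h : V.comap g = O) (P : O[X]) {x : L}
    (hx : x ∈ V) : eval₂ (g.comp O.subtype) x P ∈ V := by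
  rw [← ValuationSubring.coe_eval_map h P ⟨x, hx⟩]
  exact Subtype.prop _

open Polynomial in
theorem ValuationSubring.exists_eval₂_sub {K L : Type*} [Field K] [Field L] {g : K →+* L}
    {O : ValuationSubring K} {V : ValuationSubring L} (h : V.comap g = O) (P : O[X]) {x y : L}
    (hx : x ∈ V) (hy : y ∈ V) : ∃ z ∈ V,
      eval₂ (g.comp O.subtype) x P - eval₂ (g.comp O.subtype) y P = z * (x - y) := by
  obtain ⟨z, hz⟩ := (P.map (mapOfComap h)).evalSubFactor (⟨x, hx⟩ : V) ⟨y, hy⟩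
  refine ⟨z, z.2, ?_⟩
  have := congrArg Subtype.val hz
  rw [← ValuationSubring.coe_eval_map h P ⟨x, hx⟩, ← ValuationSubring.coe_eval_map h P ⟨y, hy⟩]
  exact this

open Polynomial in
theorem ValuationSubring.exists_eval₂_eq {K L : Type*} [Field K] [Field L] {g : K →+* L}
    {O : ValuationSubring K} {V : ValuationSubring L} (h : V.comap g = O) (P : O[X]) {x y : L}
    (hx : x ∈ V) (hy : y ∈ V) : ∃ z ∈ V,
      eval₂ (g.comp O.subtype) (x + y) P = eval₂ (g.comp O.subtype) x P
        + eval₂ (g.comp O.subtype) x (derivative P) * y + z * y ^ 2 := by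
  obtain ⟨z, hz⟩ := (P.map (mapOfComap h)).binomExpansion (⟨x, hx⟩ : V) ⟨y, hy⟩
  refine ⟨z, z.2, ?_⟩
  have := congrArg Subtype.val hz
  rw [derivative_map] at this
  rw [← ValuationSubring.coe_eval_map h P ⟨x, hx⟩,
    ← ValuationSubring.coe_eval_map h (derivative P) ⟨x, hx⟩,
    show x + y = ((⟨x, hx⟩ + ⟨y, hy⟩ : V) : L) from rfl, ← ValuationSubring.coe_eval_map h P]
  exact this

theorem ValuationSubring.inv_mem_of_valuation_eq_one {K : Type*} [Field K]
    {O : ValuationSubring K} {x : K} (hx : O.valuation x = 1) : x⁻¹ ∈ O := by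
  rw [← O.valuation_le_one_iff, map_inv₀, hx, inv_one]

open Polynomial in
/-- Adjoining a root of a polynomial which is simple modulo the maximal ideal, close to an
approximate root, preserves being `p`-adic. -/
theorem PadicRing.of_simple_root {p : ℕ} {K L : Type*} [Field K] [CharZero K] [Field L]
    [Algebra K L] [FiniteDimensional K L] {O : ValuationSubring K} {W : ValuationSubring L}
    (hp : p.Prime) (hW : W.comap (algebraMap K L) = O) (hO : PadicRing p O) {f : O[X]}
    (hf : f.Monic) {a : O} {α : L} (hα : Algebra.adjoin K {α} = ⊤)
    (hroot : eval₂ ((algebraMap K L).comp O.subtype) α f = 0)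
    (hαa : W.valuation (α - algebraMap K L a) < 1)
    (hfa : O.valuation ((f.eval a : O) : K) < 1)
    (hder : O.valuation ((f.derivative.eval a : O) : K) = 1) : PadicRing p W := by
  let _ : Algebra O L := ((algebraMap K L).comp O.subtype).toAlgebra
  have : IsScalarTower O K L := IsScalarTower.of_algebraMap_eq fun _ => rfl
  have : FaithfulSMul O L := (faithfulSMul_iff_algebraMap_injective O L).2
    ((algebraMap K L).injective.comp Subtype.val_injective)
  have : Module.IsTorsionFree O L := inferInstance
  set φ : O →+* L := (algebraMap K L).comp O.subtype with hφ
  have haev : ∀ (x : L) (P : O[X]), aeval x P = eval₂ φ x P := fun x P => rfl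
  have hφW : ∀ r : O, φ r ∈ W := ValuationSubring.map_coe_mem hW
  have haW : φ a ∈ W := hφW a
  have hd : α - φ a ∈ W := (W.valuation_le_one_iff _).1 hαa.le
  have hαW : α ∈ W := by
    have := add_mem hd haW
    rwa [sub_add_cancel] at this
  have hevφ : ∀ P : O[X], eval₂ φ (φ a) P = φ (P.eval a) := fun P => by
    rw [eval₂_at_apply]
  have hp0 : (p : L) ≠ 0 := by
    have : (p : L) = algebraMap K L p := by simp
    rw [this]
    exact (_root_.map_ne_zero _).2 hO.ne_zero
  have hdp : (α - φ a) / p ∈ W := by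
    obtain ⟨z, hz, hze⟩ := ValuationSubring.exists_eval₂_eq hW f haW hd
    rw [add_sub_cancel, ← hφ, hroot, hevφ, hevφ] at hze
    have h1 : W.valuation (φ (f.derivative.eval a) + z * (α - φ a)) = 1 := by
      have h2 : W.valuation (φ (f.derivative.eval a)) = 1 :=
        (ValuationSubring.valuation_map_eq_one_iff hW _).2 hder
      have h3 : W.valuation (z * (α - φ a)) < 1 := by
        rw [map_mul]
        exact mul_lt_one_of_nonneg_of_lt_one_right ((W.valuation_le_one_iff z).2 hz) zero_le hαa
      rw [← h2] at h3
      rw [W.valuation.map_add_eq_of_lt_left h3, h2]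
    have h4 : (α - φ a) / p = - φ ⟨((f.eval a : O) : K) / p, hO.div_mem hp hfa⟩
        * (φ (f.derivative.eval a) + z * (α - φ a))⁻¹ := by
      have h5 : φ ⟨((f.eval a : O) : K) / p, hO.div_mem hp hfa⟩ = φ (f.eval a) / p := by
        simp [hφ]
      have h6 : φ (f.derivative.eval a) + z * (α - φ a) ≠ 0 := by
        intro h; rw [h] at h1; simp at h1
      rw [h5, eq_mul_inv_iff_mul_eq₀ h6]
      field_simp
      linear_combination -hze
    rw [h4]
    exact mul_mem (neg_mem (hφW _)) (ValuationSubring.inv_mem_of_valuation_eq_one h1)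
  have happ : ∀ P : O[X], (aeval α P - φ (P.eval a)) / p ∈ W := by
    intro P
    obtain ⟨z, hz, hze⟩ := ValuationSubring.exists_eval₂_sub hW P hαW haW
    rw [haev, ← hevφ, hφ, hze, mul_div_assoc]
    exact mul_mem hz hdp
  have hpW : W.valuation (p : L) < 1 := by
    have := (ValuationSubring.valuation_map_lt_one_iff hW (p : K)).2 hO.val_lt_one
    simpa using this
  have hsmall : ∀ x : L, x / p ∈ W → W.valuation x < 1 := by
    intro x hx
    have h1 : W.valuation x = W.valuation (x / p) * W.valuation (p : L) := by
      rw [← map_mul, div_mul_cancel₀ _ hp0]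
    rw [h1]
    exact mul_lt_one_of_nonneg_of_lt_one_right ((W.valuation_le_one_iff _).2 hx) zero_le hpW
  have hval : ∀ P : O[X], W.valuation (aeval α P) = 1 → O.valuation ((P.eval a : O) : K) = 1 := by
    intro P hP
    have h1 := hsmall _ (happ P)
    refine (ValuationSubring.valuation_map_eq_one_iff hW _).1 ?_
    change W.valuation (φ (P.eval a)) = 1
    have : φ (P.eval a) = aeval α P - (aeval α P - φ (P.eval a)) := by ring
    rw [← hP] at h1
    rw [this, W.valuation.map_sub_eq_of_lt_left h1, hP]
  have hint : IsIntegral O α := ⟨f, hf, hroot⟩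
  have hgder : W.valuation (aeval α (derivative (minpoly O α))) = 1 := by
    obtain ⟨q, hq⟩ := minpoly.isIntegrallyClosed_dvd hint (p := f) hroot
    have h1 : aeval α (derivative f) = aeval α (derivative (minpoly O α)) * aeval α q := by
      rw [hq, derivative_mul]
      simp [minpoly.aeval]
    have h2 : W.valuation (aeval α (derivative f)) = 1 := by
      have h3 := hsmall _ (happ (derivative f))
      have h4 : W.valuation (φ (f.derivative.eval a)) = 1 :=
        (ValuationSubring.valuation_map_eq_one_iff hW _).2 hder
      rw [← h4] at h3
      have : aeval α (derivative f) = φ (f.derivative.eval a) +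
        (aeval α (derivative f) - φ (f.derivative.eval a)) := by ring
      rw [this, W.valuation.map_add_eq_of_lt_left h3, h4]
    rw [h1, map_mul] at h2
    have h5 : W.valuation (aeval α (derivative (minpoly O α))) ≤ 1 :=
      (W.valuation_le_one_iff _).2 (ValuationSubring.eval₂_mem hW _ hαW)
    have h6 : W.valuation (aeval α q) ≤ 1 :=
      (W.valuation_le_one_iff _).2 (ValuationSubring.eval₂_mem hW _ hαW)
    refine le_antisymm h5 (not_lt.1 fun h => ?_)
    exact absurd h2 (mul_lt_one_of_nonneg_of_lt_one_left zero_le h h6).ne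
  refine ⟨fun h => hO.inv_notMem ?_, fun x hx => ?_⟩
  · rw [← hW, ValuationSubring.mem_comap]
    simpa using h
  obtain ⟨b, c, hb, hc, hb1, hbx⟩ := exists_integral_mul_integral hW hx
    (Algebra.IsAlgebraic.isAlgebraic x)
  obtain ⟨B, hB⟩ := exists_aeval_eq_derivative_minpoly_mul hα hint hb
  obtain ⟨C, hC⟩ := exists_aeval_eq_derivative_minpoly_mul hα hint hc
  have hBx : aeval α B * x = aeval α C := by rw [hB, hC, ← hbx]; ring
  have hB1 : W.valuation (aeval α B) = 1 := by rw [hB, map_mul, hgder, hb1, one_mul]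
  have hrB := hval B hB1
  have hrC : ((C.eval a : O) : K) * ((B.eval a : O) : K)⁻¹ ∈ O :=
    mul_mem (C.eval a).2 (ValuationSubring.inv_mem_of_valuation_eq_one hrB)
  obtain ⟨k, hk⟩ := hO.approx _ hrC
  refine ⟨k, ?_⟩
  have hk' : (φ (C.eval a) * (φ (B.eval a))⁻¹ - k) / p ∈ W := by
    have h0 : (((C.eval a : O) : K) * ((B.eval a : O) : K)⁻¹ - k) / p
        ∈ W.comap (algebraMap K L) := by rw [hW]; exact hk
    rw [ValuationSubring.mem_comap] at h0
    simpa [hφ] using h0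
  have hφB1 : W.valuation (φ (B.eval a)) = 1 :=
    (ValuationSubring.valuation_map_eq_one_iff hW _).2 hrB
  have hφB0 : φ (B.eval a) ≠ 0 := by intro h; rw [h] at hφB1; simp at hφB1
  have hB0 : aeval α B ≠ 0 := by intro h; rw [h] at hB1; simp at hB1
  have hxe : x = aeval α C * (aeval α B)⁻¹ := by rw [← hBx]; field_simp
  have key : (x - k) / p = ((aeval α C - φ (C.eval a)) / p * φ (B.eval a)
      - (aeval α B - φ (B.eval a)) / p * φ (C.eval a)) * (aeval α B)⁻¹ * (φ (B.eval a))⁻¹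
      + (φ (C.eval a) * (φ (B.eval a))⁻¹ - k) / p := by
    rw [hxe]
    field_simp
    ring
  rw [key]
  exact add_mem (mul_mem (mul_mem (sub_mem (mul_mem (happ C) (hφW _)) (mul_mem (happ B) (hφW _)))
    (ValuationSubring.inv_mem_of_valuation_eq_one hB1)) (ValuationSubring.inv_mem_of_valuation_eq_one hφB1)) hk'

open Polynomial in
/-- Hensel's lemma for `p`-adic valuations, in a suitable algebraic extension. -/
theorem PadicRing.exists_ext_root {p : ℕ} {K : Type u} [Field K] [CharZero K]
    {O : ValuationSubring K} (hp : p.Prime) (hO : PadicRing p O) {f : O[X]}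
    (hf : f.Monic) {a : O} (hfa : O.valuation ((f.eval a : O) : K) < 1)
    (hder : O.valuation ((f.derivative.eval a : O) : K) = 1) :
    ∃ (L : Type u) (_ : Field L) (g : K →+* L) (W : ValuationSubring L) (α : L),
      AlgebraicExt g ∧ PadicRing p W ∧ W.comap g = O ∧
      eval₂ (g.comp O.subtype) α f = 0 ∧ W.valuation (α - g a) < 1 := by
  let Ω := AlgebraicClosure K
  obtain ⟨V, hV⟩ := exists_comap_eq (algebraMap K Ω) O
  set φ : O →+* Ω := (algebraMap K Ω).comp O.subtype with hφ
  obtain ⟨α, hα, hαa⟩ : ∃ α : Ω, eval₂ φ α f = 0 ∧ V.valuation (α - φ a) < 1 := by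
    by_contra! hcon
    have h1 : V.valuation (φ (f.eval a)) < 1 :=
      (ValuationSubring.valuation_map_lt_one_iff hV _).2 hfa
    have h2 : φ (f.eval a) = (f.map φ).eval (φ a) := by rw [eval_map_apply]
    rw [h2, (IsAlgClosed.splits (f.map φ)).eval_eq_prod_roots_of_monic (hf.map φ),
      map_multiset_prod] at h1
    refine absurd h1 (not_lt.2 (Multiset.one_le_prod_of_one_le fun y hy => ?_))
    rw [Multiset.map_map, Multiset.mem_map] at hy
    obtain ⟨α, hα, rfl⟩ := hy
    rw [mem_roots (hf.map φ).ne_zero, IsRoot.def, eval_map] at hα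
    have := hcon α hα
    rwa [Function.comp_apply, Valuation.map_sub_swap]
  have halg : IsAlgebraic K α := Algebra.IsAlgebraic.isAlgebraic α
  let L := IntermediateField.adjoin K {α}
  have : FiniteDimensional K L := IntermediateField.adjoin.finiteDimensional halg.isIntegral
  let α' : L := IntermediateField.AdjoinSimple.gen K α
  have hW : (V.comap (algebraMap L Ω)).comap (algebraMap K L) = O := by
    rw [ValuationSubring.comap_comap, ← IsScalarTower.algebraMap_eq]
    exact hV
  have hroot : eval₂ ((algebraMap K L).comp O.subtype) α' f = 0 := by
    apply (algebraMap L Ω).injective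
    rw [hom_eval₂, map_zero]
    exact hα
  have hαa' : (V.comap (algebraMap L Ω)).valuation (α' - algebraMap K L a) < 1 := by
    rw [← ValuationSubring.valuation_map_lt_one_iff rfl]
    exact hαa
  have htop : Algebra.adjoin K {α'} = ⊤ := by
    have := (IntermediateField.adjoin.powerBasis halg.isIntegral).adjoin_gen_eq_top
    rwa [IntermediateField.adjoin.powerBasis_gen] at this
  refine ⟨L, inferInstance, algebraMap K L, V.comap (algebraMap L Ω), α', fun x => ?_,
    PadicRing.of_simple_root hp hW hO hf htop hroot hαa' hfa hder, hW, hroot, hαa'⟩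
  obtain ⟨q, hq0, hq⟩ := Algebra.IsAlgebraic.isAlgebraic (R := K) x
  exact ⟨q, hq0, hq⟩

/-- For every prime `p` some polynomial `X ^ 2 + X + b` has no root modulo `p`. -/
theorem exists_forall_not_dvd_sq_add_self_add {p : ℕ} (hp : p.Prime) :
    ∃ b : ℤ, ∀ k : ℤ, ¬ (p : ℤ) ∣ k ^ 2 + k + b := by
  have : Fact p.Prime := ⟨hp⟩
  have hns : ¬ Function.Surjective (fun x : ZMod p => x ^ 2 + x) := by
    rw [← Finite.injective_iff_surjective]
    intro h
    have h1 : (0 : ZMod p) = -1 := h (by ring)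
    rw [eq_comm, neg_eq_zero] at h1
    exact one_ne_zero h1
  rw [Function.Surjective] at hns
  push Not at hns
  obtain ⟨c, hc⟩ := hns
  obtain ⟨b, rfl⟩ := ZMod.intCast_surjective c
  refine ⟨-b, fun k hk => hc k ?_⟩
  rw [← ZMod.intCast_zmod_eq_zero_iff_dvd] at hk
  push_cast at hk
  linear_combination hk

namespace PadicRing

variable {p : ℕ} {K : Type*} [Field K] {O : ValuationSubring K} {b : ℤ}

theorem val_mul_lt_one {x y : K} (hx : O.valuation x < 1) (hy : y ∈ O) :
    O.valuation (x * y) < 1 := by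
  rw [map_mul]
  exact mul_lt_one_of_nonneg_of_lt_one_left zero_le hx ((O.valuation_le_one_iff y).2 hy)

theorem val_one_add {x : K} (hx : O.valuation x < 1) : O.valuation (1 + x) = 1 := by
  rw [← O.valuation.map_one] at hx
  rw [O.valuation.map_add_eq_of_lt_left hx, map_one]

theorem mem_of_val_lt_one {x : K} (hx : O.valuation x < 1) : x ∈ O :=
  (O.valuation_le_one_iff x).1 hx.le

theorem val_inv_lt_one {x : K} (hx : x ∉ O) : O.valuation x⁻¹ < 1 := by
  rw [← O.valuation_le_one_iff, not_le] at hx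
  rw [map_inv₀]
  exact inv_lt_one_of_one_lt₀ hx

theorem val_sq_add_self_add (hp : p.Prime) (hO : PadicRing p O)
    (hb : ∀ k : ℤ, ¬ (p : ℤ) ∣ k ^ 2 + k + b) {r : K} (hr : r ∈ O) :
    O.valuation (r ^ 2 + r + b) = 1 := by
  obtain ⟨k, hk⟩ := hO.approx r hr
  have h1 : O.valuation ((r - k) * (r + k + 1)) < 1 :=
    val_mul_lt_one (hO.val_lt_one_of_div hk)
      (add_mem (add_mem hr (intCast_mem O k)) (one_mem O))
  refine le_antisymm ((O.valuation_le_one_iff _).2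
    (add_mem (add_mem (pow_mem hr 2) hr) (intCast_mem O b))) (not_lt.1 fun h => ?_)
  refine hb k ((val_int_lt_one_iff hp hO _).1 ?_)
  have : ((k ^ 2 + k + b : ℤ) : K) = r ^ 2 + r + b - (r - k) * (r + k + 1) := by
    push_cast; ring
  rw [this]
  exact O.valuation.map_sub_lt h h1

theorem val_lt_one_of_sq {x : K} (h : O.valuation (x ^ 2) < 1) : O.valuation x < 1 := by
  rw [map_pow] at h
  exact (pow_lt_one_iff two_ne_zero).1 h

/-- The binary form `s ^ 2 + s * t + b * t ^ 2` is anisotropic modulo the maximal ideal. -/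
theorem val_lt_one_of_normForm (hp : p.Prime) (hO : PadicRing p O)
    (hb : ∀ k : ℤ, ¬ (p : ℤ) ∣ k ^ 2 + k + b) {s t : K}
    (h : O.valuation (s ^ 2 + s * t + b * t ^ 2) < 1) :
    O.valuation s < 1 ∧ O.valuation t < 1 := by
  rcases le_or_gt (O.valuation s) (O.valuation t) with hst | hst
  · by_cases ht : t = 0
    · subst ht
      have : s = 0 := by simpa using hst
      simp [this]
    · have hr : s / t ∈ O := by
        rw [← O.valuation_le_one_iff, map_div₀]
        exact div_le_one_of_le₀ hst zero_le
      have h1 : s ^ 2 + s * t + b * t ^ 2 = ((s / t) ^ 2 + s / t + b) * t ^ 2 := by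
        field_simp
      rw [h1, map_mul, val_sq_add_self_add hp hO hb hr, one_mul] at h
      have := val_lt_one_of_sq h
      exact ⟨hst.trans_lt this, this⟩
  · have hs : s ≠ 0 := by rintro rfl; simp at hst
    have hr : O.valuation (t / s) < 1 := by
      rw [map_div₀]
      exact (div_lt_one₀ (by simpa [zero_lt_iff] using hs)).2 hst
    have h1 : s ^ 2 + s * t + b * t ^ 2 = (1 + t / s * (1 + b * (t / s))) * s ^ 2 := by
      field_simp
      ring
    have h2 : O.valuation (1 + t / s * (1 + b * (t / s))) = 1 :=
      val_one_add (val_mul_lt_one hr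
        (add_mem (one_mem O) (mul_mem (intCast_mem O b) (mem_of_val_lt_one hr))))
    rw [h1, map_mul, h2, one_mul] at h
    have := val_lt_one_of_sq h
    exact ⟨this, hst.trans this⟩

end PadicRing

/-- An existential condition which, over a field with a `p`-adic valuation, forces `h` to be
integral. -/
def IntegralityWitness (p : ℕ) (b : ℤ) {R : Type*} [CommRing R] (h : R) : Prop :=
  ∃ s t : R, s ^ 2 + s * t + b * t ^ 2 = b + p * h ^ 2

/-- An existential condition which forces `u` to be integral at those `p`-adic valuations at
which `g` is not integral. -/
def IntegralityWitnessAt (p : ℕ) (b : ℤ) {R : Type*} [CommRing R] (g u : R) : Prop :=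
  ∃ z : R, IntegralityWitness p b (z * u) ∧ IntegralityWitness p b ((z - 1) * g)

theorem IntegralityWitness.map {p : ℕ} {b : ℤ} {R S : Type*} [CommRing R] [CommRing S]
    (f : R →+* S) {h : R} : IntegralityWitness p b h → IntegralityWitness p b (f h) := by
  rintro ⟨s, t, hst⟩
  exact ⟨f s, f t, by simpa using congrArg f hst⟩

theorem IntegralityWitnessAt.map {p : ℕ} {b : ℤ} {R S : Type*} [CommRing R] [CommRing S]
    (f : R →+* S) {g u : R} :
    IntegralityWitnessAt p b g u → IntegralityWitnessAt p b (f g) (f u) := by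
  rintro ⟨z, h1, h2⟩
  exact ⟨f z, by simpa using h1.map f, by simpa using h2.map f⟩

theorem IntegralityWitness.mem {p : ℕ} {K : Type*} [Field K] {O : ValuationSubring K} {b : ℤ}
    (hp : p.Prime) (hO : PadicRing p O) (hb : ∀ k : ℤ, ¬ (p : ℤ) ∣ k ^ 2 + k + b) {h : K}
    (hh : IntegralityWitness p b h) : h ∈ O := by
  obtain ⟨s, t, hst⟩ := hh
  by_contra hO'
  have h0 : h ≠ 0 := by rintro rfl; exact hO' O.zero_mem
  have hp0 := hO.ne_zero
  have hx := PadicRing.val_inv_lt_one hO'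
  have h1 : (s / h) ^ 2 + (s / h) * (t / h) + b * (t / h) ^ 2 = h⁻¹ * (b * h⁻¹) + p := by
    field_simp
    linear_combination hst
  have h2 : O.valuation ((s / h) ^ 2 + (s / h) * (t / h) + b * (t / h) ^ 2) < 1 := by
    rw [h1]
    exact O.valuation.map_add_lt (PadicRing.val_mul_lt_one hx
      (mul_mem (intCast_mem O b) (PadicRing.mem_of_val_lt_one hx))) hO.val_lt_one
  obtain ⟨hs, ht⟩ := PadicRing.val_lt_one_of_normForm hp hO hb h2
  have hs' := hO.div_mem hp hs
  have ht' := hO.div_mem hp ht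
  have hx' := hO.div_mem hp hx
  refine hO.inv_notMem ?_
  have h3 : (p : K)⁻¹ = (s / h / p) ^ 2 + (s / h / p) * (t / h / p) + b * (t / h / p) ^ 2
      - b * (h⁻¹ / p) ^ 2 := by
    field_simp at h1 ⊢
    linear_combination -h1
  rw [h3]
  have hbO := intCast_mem O b
  exact sub_mem (add_mem (add_mem (pow_mem hs' 2) (mul_mem hs' ht')) (mul_mem hbO (pow_mem ht' 2)))
    (mul_mem hbO (pow_mem hx' 2))

theorem IntegralityWitnessAt.mem {p : ℕ} {K : Type*} [Field K] {O : ValuationSubring K} {b : ℤ}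
    (hp : p.Prime) (hO : PadicRing p O) (hb : ∀ k : ℤ, ¬ (p : ℤ) ∣ k ^ 2 + k + b) {g u : K}
    (hg : g ∉ O) (hu : IntegralityWitnessAt p b g u) : u ∈ O := by
  obtain ⟨z, h1, h2⟩ := hu
  have h3 := h1.mem hp hO hb
  have h4 := h2.mem hp hO hb
  have hg0 : g ≠ 0 := by rintro rfl; exact hg O.zero_mem
  have h5 : O.valuation (z - 1) < 1 := by
    have := PadicRing.val_mul_lt_one (PadicRing.val_inv_lt_one hg) h4
    rwa [show g⁻¹ * ((z - 1) * g) = z - 1 by field_simp] at this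
  have h6 : O.valuation z = 1 := by
    have := PadicRing.val_one_add h5
    rwa [add_sub_cancel] at this
  have hz0 : z ≠ 0 := by rintro rfl; simp at h6
  have := mul_mem (ValuationSubring.inv_mem_of_valuation_eq_one h6) h3
  rwa [inv_mul_cancel_left₀ hz0] at this

/-- Distinct `p`-adic valuation rings are incomparable. -/
theorem PadicRing.eq_of_le {p : ℕ} {K : Type*} [Field K] {O O' : ValuationSubring K}
    (hp : p.Prime) (hO : PadicRing p O) (hO' : PadicRing p O') (h : O ≤ O') : O = O' := by
  refine le_antisymm h fun x hx => ?_
  by_contra hxO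
  have h1 := hO.div_mem hp (val_inv_lt_one hxO)
  have hx0 : x ≠ 0 := by rintro rfl; exact hxO O.zero_mem
  refine hO'.inv_notMem ?_
  rw [show (p : K)⁻¹ = x⁻¹ / p * x by field_simp]
  exact mul_mem (h h1) hx

/-- Given finitely many distinct `p`-adic valuation rings, some element is integral at all but
one prescribed of them. -/
theorem exists_notMem_forall_mem {p : ℕ} {n : ℕ} {K : Type*} [Field K]
    {O : Fin n → ValuationSubring K} (hp : p.Prime) (hinj : Function.Injective O)
    (hO : ∀ i, PadicRing p (O i)) (i : Fin n) : ∃ g : K, g ∉ O i ∧ ∀ j, j ≠ i → g ∈ O j := by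
  classical
  obtain ⟨b, hb⟩ := exists_forall_not_dvd_sq_add_self_add hp
  have hex : ∀ k, k ≠ i → ∃ t : K, (∀ j, t ∈ O j) ∧ (O i).valuation t = 1 ∧
      (O k).valuation t < 1 := by
    intro k hk
    have hnle : ¬ O i ≤ O k := fun h => hk (hinj ((hO i).eq_of_le hp (hO k) h)).symm
    obtain ⟨h, hi, hk'⟩ := SetLike.not_le_iff_exists.1 hnle
    have hkey : ∀ j, h ∉ O j → (O j).valuation (h ^ 2 + h + b)⁻¹ < 1 := by
      intro j hj
      have h0 : h ≠ 0 := by rintro rfl; exact hj (O j).zero_mem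
      have hx := PadicRing.val_inv_lt_one hj
      have h1 : h ^ 2 + h + b = (1 + h⁻¹ * (1 + b * h⁻¹)) * h ^ 2 := by
        field_simp
        ring
      have h2 : (O j).valuation (1 + h⁻¹ * (1 + b * h⁻¹)) = 1 :=
        PadicRing.val_one_add (PadicRing.val_mul_lt_one hx (add_mem (one_mem _)
          (mul_mem (intCast_mem _ b) (PadicRing.mem_of_val_lt_one hx))))
      rw [h1, mul_inv, map_mul, map_inv₀ _ (1 + _), h2, inv_one, one_mul, ← inv_pow, map_pow]
      exact pow_lt_one₀ zero_le hx two_ne_zero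
    refine ⟨(h ^ 2 + h + b)⁻¹, fun j => ?_, ?_, hkey k hk'⟩
    · by_cases hj : h ∈ O j
      · exact ValuationSubring.inv_mem_of_valuation_eq_one
          (PadicRing.val_sq_add_self_add hp (hO j) hb hj)
      · exact PadicRing.mem_of_val_lt_one (hkey j hj)
    · rw [map_inv₀, PadicRing.val_sq_add_self_add hp (hO i) hb hi, inv_one]
  choose! t ht1 ht2 ht3 using hex
  have hmem : ∀ j, (∏ k ∈ Finset.univ.erase i, t k) ∈ O j := fun j =>
    prod_mem fun k hk => ht1 k (Finset.ne_of_mem_erase hk) j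
  refine ⟨(∏ k ∈ Finset.univ.erase i, t k) / p, fun h => ?_, fun j hj => ?_⟩
  · have h1 := (hO i).val_lt_one_of_div h
    rw [map_prod, Finset.prod_congr rfl fun k hk => ht2 k (Finset.ne_of_mem_erase hk)] at h1
    simp at h1
  · refine (hO j).div_mem hp ?_
    rw [← Finset.mul_prod_erase _ _ (Finset.mem_erase.2 ⟨hj, Finset.mem_univ j⟩)]
    exact PadicRing.val_mul_lt_one (ht3 j hj) (prod_mem fun k hk =>
      ht1 k (Finset.ne_of_mem_erase (Finset.mem_of_mem_erase hk)) j)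

theorem add_pow_add_two {R : Type*} [CommSemiring R] (x c : R) (n : ℕ) :
    (x + c) ^ (n + 2) = x ^ (n + 2) + ((n + 2 : ℕ) : R) * x ^ (n + 1) * c +
      (∑ k ∈ Finset.range (n + 1), (((n + 2).choose k : ℕ) : R) * c ^ (n - k) * x ^ k) * c ^ 2 := by
  rw [add_pow, Finset.sum_range_succ, Finset.sum_range_succ, Finset.sum_mul]
  have h : ∀ k ∈ Finset.range (n + 1), x ^ k * c ^ (n + 2 - k) * (((n + 2).choose k : ℕ) : R) =
      (((n + 2).choose k : ℕ) : R) * c ^ (n - k) * x ^ k * c ^ 2 := by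
    intro k hk
    rw [Finset.mem_range] at hk
    rw [show n + 2 - k = n - k + 2 by omega, pow_add]
    ring
  rw [Finset.sum_congr rfl h, show n + 2 - (n + 1) = 1 by omega, Nat.sub_self, Nat.choose_self,
    Nat.choose_succ_self_right]
  ring

open Polynomial in
theorem exists_pow_eq_of_val_eq_one {p : ℕ} {M : Type u} [Field M] [CharZero M]
    {OM : ValuationSubring M} (hp : p.Prime) (hM : IsPadicallyClosedPair p OM) {m : ℕ}
    (hm : 1 ≤ m) {v : M} (hv : OM.valuation v = 1) : ∃ y : M, 1 + p * m ^ 2 * v = y ^ m := by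
  have hO := PadicRing.of_isPadicValRing hp hM.1
  obtain rfl | ⟨n, rfl⟩ : m = 1 ∨ ∃ n, m = n + 2 := by
    rcases Nat.eq_or_lt_of_le hm with h | h
    · exact Or.inl h.symm
    · exact Or.inr ⟨m - 2, by omega⟩
  · exact ⟨_, (pow_one _).symm⟩
  set m := n + 2 with hmn
  let q : OM := ⟨v⁻¹, ValuationSubring.inv_mem_of_valuation_eq_one hv⟩
  have hv0 : v ≠ 0 := by rintro rfl; simp at hv
  have hqv : OM.valuation (q : M) = 1 := by change OM.valuation v⁻¹ = 1; rw [map_inv₀, hv, inv_one]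
  let H : OM[X] := ∑ k ∈ Finset.range (n + 1),
    C (((m.choose k : ℕ) : OM) * ((p * m : ℕ) : OM) ^ (n - k)) * X ^ k
  let f : OM[X] := X ^ (n + 1 + 1) - C q * (X ^ (n + 1) + C (p : OM) * H)
  have hH : H.degree ≤ (n + 1 : ℕ) := by
    refine (degree_sum_le _ _).trans (Finset.sup_le fun k hk => ?_)
    refine (degree_C_mul_X_pow_le _ _).trans ?_
    rw [Finset.mem_range] at hk
    exact_mod_cast hk.le
  have hC : ∀ (c : OM) (P : OM[X]), (C c * P).degree ≤ P.degree := fun c P => by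
    rw [← smul_eq_C_mul]
    exact degree_smul_le _ _
  have hf : f.Monic := by
    refine monic_X_pow_sub ?_
    refine LE.le.trans_lt (b := ((n + 1 : ℕ) : WithBot ℕ)) ?_ (by exact_mod_cast Nat.lt_succ_self _)
    refine (hC _ _).trans ((degree_add_le _ _).trans (max_le (degree_X_pow_le _) ?_))
    exact (hC _ _).trans hH
  have hpO : OM.valuation (((p : OM) : OM) : M) < 1 := by simpa using hO.val_lt_one
  have hf1 : f.eval q = (p : OM) * (-q * H.eval q) := by
    simp [f]
    ring
  have hf2 : f.derivative.eval q = q ^ (n + 1) + (p : OM) * (-q * H.derivative.eval q) := by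
    simp [f]
    ring
  have hfa : OM.valuation ((f.eval q : OM) : M) < 1 := by
    rw [hf1]
    exact PadicRing.val_mul_lt_one hpO (Subtype.prop _)
  have hder : OM.valuation ((f.derivative.eval q : OM) : M) = 1 := by
    have h1 : OM.valuation (((p : OM) * (-q * H.derivative.eval q) : OM) : M) <
        OM.valuation ((q ^ (n + 1) : OM) : M) := by
      have : OM.valuation ((q ^ (n + 1) : OM) : M) = 1 := by
        push_cast; rw [map_pow, hqv, one_pow]
      rw [this]
      exact PadicRing.val_mul_lt_one hpO (Subtype.prop _)
    rw [hf2]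
    push_cast at h1 ⊢
    rw [OM.valuation.map_add_eq_of_lt_left h1, map_pow, hqv, one_pow]
  obtain ⟨L, _, g, W, α, halg, hW, hcomap, hroot, hα⟩ :=
    PadicRing.exists_ext_root hp hO hf hfa hder
  obtain ⟨r, rfl⟩ := hM.2 L g halg W (hW.isPadicValRing hp) hcomap α
  rw [← map_sub, ValuationSubring.valuation_map_lt_one_iff hcomap] at hα
  have hr : OM.valuation r = 1 := by
    rw [← hqv] at hα
    have : r = q + (r - q) := by ring
    rw [this, OM.valuation.map_add_eq_of_lt_left hα, hqv]
  have hr0 : r ≠ 0 := by rintro rfl; simp at hr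
  rw [← hom_eval₂, _root_.map_eq_zero] at hroot
  set h := eval₂ OM.subtype r H with hh
  have hroot' : r ^ m = v⁻¹ * (r ^ (n + 1) + p * h) := by
    simp only [f, eval₂_sub, eval₂_mul, eval₂_add, eval₂_X_pow, eval₂_C] at hroot
    rw [← hh] at hroot
    exact sub_eq_zero.1 (by simpa using hroot)
  have hsum : h = ∑ k ∈ Finset.range (n + 1),
      ((m.choose k : ℕ) : M) * ((p * m : ℕ) : M) ^ (n - k) * r ^ k := by
    simp only [hh, H, eval₂_finsetSum, eval₂_mul, eval₂_X_pow, eval₂_C]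
    simp
  refine ⟨(r + (p * m : ℕ)) / r, ?_⟩
  rw [div_pow, eq_div_iff (pow_ne_zero _ hr0), add_pow_add_two, ← hsum, ← hmn]
  have h2 : v * r ^ m = r ^ (n + 1) + p * h := by rw [hroot']; field_simp
  push_cast
  linear_combination (p * m ^ 2 : M) * h2

theorem exists_pow_eq_of_mem {p : ℕ} {M : Type u} [Field M] [CharZero M]
    {OM : ValuationSubring M} (hp : p.Prime) (hM : IsPadicallyClosedPair p OM) {m : ℕ}
    (hm : 1 ≤ m) {u : M} (hu : u ∈ OM) : ∃ y : M, 1 + p * m ^ 2 * u = y ^ m := by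
  have hO := PadicRing.of_isPadicValRing hp hM.1
  rcases ((OM.valuation_le_one_iff u).2 hu).eq_or_lt with h1 | h1
  · exact exists_pow_eq_of_val_eq_one hp hM hm h1
  · have hd : OM.valuation (1 + (p : M) * m ^ 2) = 1 :=
      PadicRing.val_one_add (PadicRing.val_mul_lt_one hO.val_lt_one
        (pow_mem (natCast_mem OM m) 2))
    have hd0 : (1 + (p : M) * m ^ 2) ≠ 0 := by intro h; rw [h] at hd; simp at hd
    obtain ⟨y, hy⟩ := exists_pow_eq_of_val_eq_one hp hM hm (OM.valuation.map_one)
    have hw : OM.valuation ((u - 1) / (1 + (p : M) * m ^ 2)) = 1 := by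
      rw [map_div₀, hd, div_one, Valuation.map_sub_swap, sub_eq_add_neg]
      exact PadicRing.val_one_add (by rwa [Valuation.map_neg])
    obtain ⟨z, hz⟩ := exists_pow_eq_of_val_eq_one hp hM hm hw
    refine ⟨y * z, ?_⟩
    rw [mul_pow, ← hy, ← hz]
    field_simp
    ring

section LaurentSeries

open PowerSeries

/-- The valuation ring of Laurent series without pole whose constant term lies in a given
valuation ring. -/
noncomputable def ValuationSubring.laurent {N : Type*} [Field N] (V : ValuationSubring N) :
    ValuationSubring (LaurentSeries N) where
  toSubring := (V.toSubring.comap (constantCoeff (R := N))).map (HahnSeries.ofPowerSeries ℤ N)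
  mem_or_inv_mem' x := by
    have key : ∀ f : N⟦X⟧, HahnSeries.ofPowerSeries ℤ N f ∈
        (V.toSubring.comap (constantCoeff (R := N))).map (HahnSeries.ofPowerSeries ℤ N) ∨
        (HahnSeries.ofPowerSeries ℤ N f)⁻¹ ∈
        (V.toSubring.comap (constantCoeff (R := N))).map (HahnSeries.ofPowerSeries ℤ N) := by
      intro f
      rcases V.mem_or_inv_mem (constantCoeff f) with h | h
      · exact Or.inl ⟨f, h, rfl⟩
      · by_cases h0 : constantCoeff f = 0
        · exact Or.inl ⟨f, by change constantCoeff f ∈ V; rw [h0]; exact V.zero_mem, rfl⟩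
        · refine Or.inr ⟨f⁻¹, by change constantCoeff f⁻¹ ∈ V; rwa [constantCoeff_inv], ?_⟩
          refine eq_inv_of_mul_eq_one_left ?_
          rw [← map_mul, PowerSeries.inv_mul_cancel _ h0, map_one]
    rcases ValuationRing.isInteger_or_isInteger (N⟦X⟧) x with ⟨f, hf⟩ | ⟨f, hf⟩
    · rw [← hf]
      exact key f
    · rw [← inv_inv x, ← hf, or_comm, inv_inv]
      exact key f

theorem ValuationSubring.ofPowerSeries_mem_laurent {N : Type*} [Field N] {V : ValuationSubring N}
    (f : N⟦X⟧) : HahnSeries.ofPowerSeries ℤ N f ∈ V.laurent ↔ constantCoeff f ∈ V := by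
  refine ⟨fun ⟨g, hg, hgf⟩ => ?_, fun h => ⟨f, h, rfl⟩⟩
  rw [← HahnSeries.ofPowerSeries_injective hgf]
  exact hg

theorem ValuationSubring.comap_laurent {N : Type*} [Field N] (V : ValuationSubring N) :
    V.laurent.comap ((HahnSeries.ofPowerSeries ℤ N).comp (C (R := N))) = V := by
  ext x
  rw [ValuationSubring.mem_comap, RingHom.comp_apply, ofPowerSeries_mem_laurent, constantCoeff_C]

theorem PadicRing.laurent {p : ℕ} {N : Type*} [Field N] {V : ValuationSubring N}
    (h : PadicRing p V) : PadicRing p V.laurent where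
  inv_notMem := by
    have := h.inv_notMem
    rw [← V.comap_laurent, ValuationSubring.mem_comap] at this
    simpa using this
  approx x hx := by
    obtain ⟨f, hf, rfl⟩ := hx
    obtain ⟨k, hk⟩ := h.approx _ hf
    refine ⟨k, (f - (k : N⟦X⟧)) * C ((p : N)⁻¹), ?_, ?_⟩
    · change constantCoeff ((f - (k : N⟦X⟧)) * C ((p : N)⁻¹)) ∈ V
      simpa [div_eq_mul_inv] using hk
    · have : HahnSeries.ofPowerSeries ℤ N (C ((p : N)⁻¹)) = (p : LaurentSeries N)⁻¹ := by
        rw [← RingHom.comp_apply, map_inv₀, map_natCast]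
      rw [map_mul, this, div_eq_mul_inv, map_sub, map_intCast]

end LaurentSeries

theorem RegularExt.comp {F L E : Type*} [Field F] [Field L] [Field E] {f : F →+* L} {g : L →+* E}
    (hf : RegularExt f) (hg : RegularExt g) : RegularExt (g.comp f) := by
  rintro x ⟨q, hq0, hq⟩
  obtain ⟨y, rfl⟩ := hg x ⟨q.map f, (Polynomial.map_ne_zero_iff f.injective).2 hq0, by
    rwa [Polynomial.eval₂_map]⟩
  rw [← Polynomial.hom_eval₂, map_eq_zero] at hq
  obtain ⟨z, rfl⟩ := hf y ⟨q, hq0, hq⟩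
  exact ⟨z, rfl⟩

theorem regularExt_ratFunc (L : Type*) [Field L] : RegularExt (RatFunc.C (K := L)) := by
  rintro x ⟨q, hq0, hq⟩
  by_contra hx
  refine RatFunc.transcendental_of_ne_C x (fun ⟨c, hc⟩ => hx ⟨c, hc.symm⟩) ⟨q, hq0, ?_⟩
  rwa [Polynomial.aeval_def, RatFunc.algebraMap_eq_C]

open Polynomial in
/-- The embedding of `L(X)` into Laurent series over `N` sending `X` to a given element of `N`
plus the uniformizer. -/
theorem exists_ratFunc_to_laurent {L N : Type*} [Field L] [Field N] (lam : L →+* N) (y : N) :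
    ∃ ψ : RatFunc L →+* LaurentSeries N,
      ψ.comp RatFunc.C = (HahnSeries.ofPowerSeries ℤ N).comp ((PowerSeries.C (R := N)).comp lam) ∧
      ψ RatFunc.X = HahnSeries.ofPowerSeries ℤ N (PowerSeries.C y + PowerSeries.X) := by
  let θ : L[X] →+* LaurentSeries N := (HahnSeries.ofPowerSeries ℤ N).comp
    ((coeToPowerSeries.ringHom (R := N)).comp ((taylorAlgHom y).toRingHom.comp (mapRingHom lam)))
  have hθ : Function.Injective θ := by
    refine HahnSeries.ofPowerSeries_injective.comp ?_
    refine (coe_injective N).comp ?_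
    exact (taylor_injective y).comp (map_injective lam lam.injective)
  have hθ' : nonZeroDivisors L[X] ≤ (nonZeroDivisors (LaurentSeries N)).comap θ := by
    intro q hq
    rw [Submonoid.mem_comap, mem_nonZeroDivisors_iff_ne_zero]
    exact (map_ne_zero_iff θ hθ).2 (nonZeroDivisors.ne_zero hq)
  refine ⟨RatFunc.liftRingHom θ hθ', ?_, ?_⟩
  · ext1 x
    have : RatFunc.C x = algebraMap L[X] (RatFunc L) (C x) / algebraMap L[X] (RatFunc L) 1 := by
      simp
    rw [RingHom.comp_apply, this, RatFunc.liftRingHom_apply_div]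
    simp [θ]
  · have : (RatFunc.X : RatFunc L) =
      algebraMap L[X] (RatFunc L) X / algebraMap L[X] (RatFunc L) 1 := by simp
    rw [this, RatFunc.liftRingHom_apply_div]
    simp [θ, add_comm]

/-- A regular extension of `F` together with an embedding into a `p`-adically valued field for
each of the given valuation rings of `F`. -/
structure PadicModel (p n : ℕ) {F : Type u} [Field F] (O : Fin n → ValuationSubring F) where
  /-- the extension field -/
  L : Type u
  [fieldL : Field L]
  /-- the structure map -/
  ι : F →+* L
  reg : RegularExt ι
  /-- the valued fields -/
  N : Fin n → Type u
  [fieldN : ∀ i, Field (N i)]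
  /-- the embeddings into the valued fields -/
  lam : ∀ i, L →+* N i
  /-- the valuation rings -/
  ON : ∀ i, ValuationSubring (N i)
  padic : ∀ i, PadicRing p (ON i)
  comap_eq : ∀ i, (ON i).comap ((lam i).comp ι) = O i

attribute [instance] PadicModel.fieldL PadicModel.fieldN

namespace PadicModel

variable {p n : ℕ} {F : Type u} [Field F] {O : Fin n → ValuationSubring F}

/-- Morphisms of models. -/
structure Hom (A B : PadicModel p n O) where
  /-- the map of extension fields -/
  f : A.L →+* B.L
  /-- the maps of valued fields -/
  g : ∀ i, A.N i →+* B.N i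
  comm : ∀ i, (g i).comp (A.lam i) = (B.lam i).comp f
  ι_eq : f.comp A.ι = B.ι
  comap : ∀ i, (B.ON i).comap (g i) = A.ON i

/-- The identity morphism. -/
def Hom.id (A : PadicModel p n O) : Hom A A where
  f := RingHom.id _
  g _ := RingHom.id _
  comm _ := rfl
  ι_eq := rfl
  comap _ := rfl

/-- Composition of morphisms. -/
def Hom.comp {A B C : PadicModel p n O} (φ : Hom A B) (ψ : Hom B C) : Hom A C where
  f := ψ.f.comp φ.f
  g i := (ψ.g i).comp (φ.g i)
  comm i := by
    rw [RingHom.comp_assoc, φ.comm, ← RingHom.comp_assoc, ψ.comm, RingHom.comp_assoc]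
  ι_eq := by rw [RingHom.comp_assoc, φ.ι_eq, ψ.ι_eq]
  comap i := by rw [← ValuationSubring.comap_comap, ψ.comap, φ.comap]

theorem Hom.comm_apply {A B : PadicModel p n O} (φ : Hom A B) (i : Fin n) (x : A.L) :
    B.lam i (φ.f x) = φ.g i (A.lam i x) :=
  (RingHom.congr_fun (φ.comm i) x).symm

theorem Hom.ι_apply {A B : PadicModel p n O} (φ : Hom A B) (x : F) : φ.f (A.ι x) = B.ι x :=
  RingHom.congr_fun φ.ι_eq x

theorem Hom.map_mem_iff {A B : PadicModel p n O} (φ : Hom A B) (i : Fin n) (x : A.N i) :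
    φ.g i x ∈ B.ON i ↔ x ∈ A.ON i := by
  rw [← φ.comap, ValuationSubring.mem_comap]

theorem lam_ι_mem_iff (A : PadicModel p n O) (i : Fin n) (x : F) :
    A.lam i (A.ι x) ∈ A.ON i ↔ x ∈ O i := by
  rw [← A.comap_eq, ValuationSubring.mem_comap]
  rfl

/-- The model obtained by extending all the fields of a given model. -/
def extend (A : PadicModel p n O) {L' : Type u} [Field L'] (f : A.L →+* L') (hf : RegularExt f)
    {N' : Fin n → Type u} [∀ i, Field (N' i)] (lam' : ∀ i, L' →+* N' i) (g : ∀ i, A.N i →+* N' i)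
    (comm : ∀ i, (g i).comp (A.lam i) = (lam' i).comp f) (ON' : ∀ i, ValuationSubring (N' i))
    (hON' : ∀ i, PadicRing p (ON' i)) (hcomap : ∀ i, (ON' i).comap (g i) = A.ON i) :
    PadicModel p n O where
  L := L'
  ι := f.comp A.ι
  reg := A.reg.comp hf
  N := N'
  lam := lam'
  ON := ON'
  padic := hON'
  comap_eq i := by
    rw [← RingHom.comp_assoc, ← comm, RingHom.comp_assoc, ← ValuationSubring.comap_comap, hcomap,
      A.comap_eq]

/-- The canonical morphism to an extended model. -/
def toExtend (A : PadicModel p n O) {L' : Type u} [Field L'] (f : A.L →+* L') (hf : RegularExt f)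
    {N' : Fin n → Type u} [∀ i, Field (N' i)] (lam' : ∀ i, L' →+* N' i) (g : ∀ i, A.N i →+* N' i)
    (comm : ∀ i, (g i).comp (A.lam i) = (lam' i).comp f) (ON' : ∀ i, ValuationSubring (N' i))
    (hON' : ∀ i, PadicRing p (ON' i)) (hcomap : ∀ i, (ON' i).comap (g i) = A.ON i) :
    Hom A (A.extend f hf lam' g comm ON' hON' hcomap) where
  f := f
  g := g
  comm := comm
  ι_eq := rfl
  comap := hcomap

/-- Every model extends to one with an element which is infinitely close to prescribed elements
of the valued fields and transcendental over the original field. -/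
theorem exists_generic (A : PadicModel p n O) (y : ∀ i, A.N i) :
    ∃ (B : PadicModel p n O) (φ : Hom A B) (z : B.L),
      (∃ e : RatFunc A.L ≃+* B.L, φ.f = e.toRingHom.comp RatFunc.C ∧ z = e RatFunc.X) ∧
      ∀ i, ∀ c : A.N i, φ.g i c * (B.lam i z - φ.g i (y i)) ∈ B.ON i := by
  choose ψ hψ hψX using fun i => exists_ratFunc_to_laurent (A.lam i) (y i)
  refine ⟨_, A.toExtend (RatFunc.C (K := A.L)) (regularExt_ratFunc _) ψ
    (fun i => (HahnSeries.ofPowerSeries ℤ (A.N i)).comp (PowerSeries.C (R := A.N i)))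
    (fun i => by rw [hψ]; rfl) (fun i => (A.ON i).laurent) (fun i => (A.padic i).laurent)
    (fun i => (A.ON i).comap_laurent), RatFunc.X, ⟨RingEquiv.refl _, rfl, rfl⟩, fun i c => ?_⟩
  change HahnSeries.ofPowerSeries ℤ (A.N i) (PowerSeries.C c) *
    (ψ i RatFunc.X - HahnSeries.ofPowerSeries ℤ (A.N i) (PowerSeries.C (y i))) ∈ (A.ON i).laurent
  rw [hψX, map_add, add_sub_cancel_left, ← map_mul, ValuationSubring.ofPowerSeries_mem_laurent]
  simp [(A.ON i).zero_mem]

end PadicModel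

section Conic

open Polynomial

theorem sq_mul_ne_C_mul_sq {K : Type*} [Field K] [CharZero K] {δ c κ : K} (hδ : δ ≠ 0)
    (hc : c ≠ 0) {n d : K[X]} (hn : n ≠ 0) :
    n ^ 2 * (C δ * X ^ 2 + C (4 * c)) ≠ C κ * d ^ 2 := by
  intro h
  have hΔ : (C δ * X ^ 2 + C (4 * c) : K[X]).coeff 2 = δ := by simp
  have hΔ0 : (C δ * X ^ 2 + C (4 * c) : K[X]) ≠ 0 := fun h0 => hδ (by rw [← hΔ, h0, coeff_zero])
  have hκ : κ ≠ 0 := by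
    rintro rfl
    rw [C_0, zero_mul] at h
    exact mul_ne_zero (pow_ne_zero 2 hn) hΔ0 h
  have hdvd : n ^ 2 ∣ d ^ 2 := by
    refine ⟨C κ⁻¹ * (C δ * X ^ 2 + C (4 * c)), ?_⟩
    rw [mul_left_comm, h, ← mul_assoc, ← C_mul, inv_mul_cancel₀ hκ, C_1, one_mul]
  obtain ⟨e, rfl⟩ := (IsIntegrallyClosed.pow_dvd_pow_iff two_ne_zero).1 hdvd
  have he : C δ * X ^ 2 + C (4 * c) = C κ * e ^ 2 := by
    refine mul_left_cancel₀ (pow_ne_zero 2 hn) ?_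
    rw [h]
    ring
  have hd := congrArg derivative he
  have hunit : IsUnit e := by
    have h1 : e ∣ C (8 * c) := by
      refine ⟨2 * C κ * e - X * (2 * C κ * derivative e), ?_⟩
      simp only [derivative_add, derivative_mul, derivative_C, derivative_pow,
        zero_mul, zero_add, add_zero] at hd
      have h2 : (C (8 * c) : K[X]) = 2 * C (4 * c) := by
        rw [show (8 * c : K) = 4 * c + 4 * c by ring, C_add, two_mul]
      rw [h2]
      norm_num at hd
      rw [show (C 2 : K[X]) = 2 from map_ofNat C 2] at hd
      linear_combination 2 * he - X * hd
    refine isUnit_of_dvd_unit h1 (isUnit_C.2 (IsUnit.mk0 _ (mul_ne_zero ?_ hc)))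
    norm_num
  obtain ⟨r, -, rfl⟩ := isUnit_iff.1 hunit
  rw [he, ← C_pow, ← C_mul, coeff_C] at hΔ
  simp only [OfNat.ofNat_ne_zero, if_false] at hΔ
  exact hδ hΔ.symm

theorem RatFunc.sq_mul_ne_C {K : Type*} [Field K] [CharZero K] {δ c : K} (hδ : δ ≠ 0)
    (hc : c ≠ 0) {y : RatFunc K} (hy : y ≠ 0) (κ : K) :
    y ^ 2 * (RatFunc.C δ * RatFunc.X ^ 2 + RatFunc.C (4 * c)) ≠ RatFunc.C κ := by
  intro h
  have hd : algebraMap K[X] (RatFunc K) y.denom ≠ 0 := RatFunc.algebraMap_ne_zero y.denom_ne_zero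
  have hy' := RatFunc.num_div_denom y
  refine sq_mul_ne_C_mul_sq (κ := κ) (d := y.denom) hδ hc (RatFunc.num_ne_zero hy) ?_
  apply RatFunc.algebraMap_injective K
  rw [← hy'] at h
  simp only [map_mul, map_add, map_pow, RatFunc.algebraMap_C, RatFunc.algebraMap_X] at h ⊢
  field_simp at h
  linear_combination h

theorem regularExt_of_quadratic {K E' : Type*} [Field K] [CharZero K] [Field E']
    (g : RatFunc K →+* E') {b c : K} (hb : 1 - 4 * b ≠ 0) (hc : c ≠ 0) {s : E'}
    (hs : s ^ 2 + g RatFunc.X * s + g (RatFunc.C b) * g RatFunc.X ^ 2 = g (RatFunc.C c))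
    (hgen : ∀ x : E', ∃ a d, x = g a + g d * s) : RegularExt (g.comp RatFunc.C) := by
  rintro x ⟨q, hq0, hq⟩
  by_cases hx : x ∈ g.range
  · obtain ⟨a, rfl⟩ := hx
    rw [← hom_eval₂, _root_.map_eq_zero] at hq
    obtain ⟨r, rfl⟩ := regularExt_ratFunc K a ⟨q, hq0, hq⟩
    exact ⟨r, rfl⟩
  exfalso
  obtain ⟨a, d, hxad⟩ := hgen x
  set t : RatFunc K := RatFunc.X with ht
  set T := 2 * a - d * t with hT
  set D := a ^ 2 - a * d * t + d ^ 2 * (RatFunc.C b * t ^ 2 - RatFunc.C c) with hD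
  have hd0 : d ≠ 0 := by
    rintro rfl
    exact hx ⟨a, by simp [hxad]⟩
  have hxq : x ^ 2 - g T * x + g D = 0 := by
    rw [hxad, hT, hD]
    simp only [map_add, map_sub, map_mul, map_pow, map_ofNat]
    linear_combination (g d) ^ 2 * hs
  let m : (RatFunc K)[X] := X ^ 2 + (C (-T) * X + C D)
  have hm : m.Monic := monic_X_pow_add (by compute_degree!)
  have hmdeg : m.natDegree = 2 := by
    simp only [m]
    compute_degree!
  have heval : ∀ y : E', eval₂ g y m = y ^ 2 - g T * y + g D := by
    intro y
    simp [m]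
    ring
  have hr : (q.map RatFunc.C) %ₘ m = 0 := by
    set r := (q.map RatFunc.C) %ₘ m
    have hrx : eval₂ g x r = 0 := by
      have h1 := congrArg (eval₂ g x) (modByMonic_add_div (q.map RatFunc.C) m)
      rw [eval₂_add, eval₂_mul, heval, hxq, zero_mul, add_zero, eval₂_map, hq] at h1
      exact h1
    have hrd : r.natDegree < 2 := by
      rw [← hmdeg]
      refine natDegree_modByMonic_lt _ hm ?_
      intro h
      rw [h, natDegree_one] at hmdeg
      omega
    have hr1 : r = C (r.coeff 1) * X + C (r.coeff 0) :=
      eq_X_add_C_of_natDegree_le_one (by omega)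
    rw [hr1] at hrx
    simp only [eval₂_add, eval₂_mul, eval₂_C, eval₂_X] at hrx
    have h1 : r.coeff 1 = 0 := by
      by_contra h1
      refine hx ⟨-(r.coeff 0 / r.coeff 1), ?_⟩
      have h2 : g (r.coeff 1) ≠ 0 := (_root_.map_ne_zero g).2 h1
      rw [map_neg, map_div₀]
      field_simp
      linear_combination -hrx
    rw [h1, map_zero, zero_mul, zero_add, _root_.map_eq_zero] at hrx
    rw [hr1, h1, hrx]
    simp
  have hconj : eval₂ (g.comp RatFunc.C) (g T - x) q = 0 := by
    rw [← eval₂_map, ← modByMonic_add_div (q.map RatFunc.C) m, hr, zero_add,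
      eval₂_mul, heval]
    have : (g T - x) ^ 2 - g T * (g T - x) + g D = 0 := by rw [← hxq]; ring
    rw [this, zero_mul]
  let _ : Algebra K E' := (g.comp RatFunc.C).toAlgebra
  have halg1 : IsAlgebraic K x := ⟨q, hq0, hq⟩
  have halg2 : IsAlgebraic K (g T - x) := ⟨q, hq0, hconj⟩
  obtain ⟨q', hq'0, hq'⟩ := (halg1.sub halg2).pow 2
  have hsq : (x - (g T - x)) ^ 2 =
      g (d ^ 2 * (RatFunc.C (1 - 4 * b) * t ^ 2 + RatFunc.C (4 * c))) := by
    have h1 : x ^ 2 - g T * x = - g D := by linear_combination hxq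
    have h2 : (x - (g T - x)) ^ 2 = 4 * (x ^ 2 - g T * x) + g T ^ 2 := by ring
    rw [h2, h1, hT, hD]
    simp only [map_add, map_sub, map_mul, map_pow, map_ofNat, map_one]
    ring
  rw [hsq] at hq'
  have hq'' : eval₂ (g.comp RatFunc.C)
      (g (d ^ 2 * (RatFunc.C (1 - 4 * b) * t ^ 2 + RatFunc.C (4 * c)))) q' = 0 := hq'
  rw [← hom_eval₂, _root_.map_eq_zero] at hq''
  obtain ⟨κ, hκ⟩ := regularExt_ratFunc K _ ⟨q', hq'0, hq''⟩
  exact RatFunc.sq_mul_ne_C hb hc hd0 κ hκ.symm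

/-- The function field of the conic `s ^ 2 + s * t + b * t ^ 2 = c`. -/
theorem exists_conic_extension {K : Type u} [Field K] [CharZero K] {b c : K}
    (hb : 1 - 4 * b ≠ 0) (hc : c ≠ 0) :
    ∃ (E' : Type u) (_ : Field E') (g : RatFunc K →+* E') (s : E'),
      s ^ 2 + g RatFunc.X * s + g (RatFunc.C b) * g RatFunc.X ^ 2 = g (RatFunc.C c) ∧
      RegularExt (g.comp RatFunc.C) ∧
      ∀ (N : Type u) [Field N] (ψ : RatFunc K →+* N) (S : N),
        S ^ 2 + ψ RatFunc.X * S + ψ (RatFunc.C b) * ψ RatFunc.X ^ 2 = ψ (RatFunc.C c) →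
        ∃ ψ' : E' →+* N, ψ'.comp g = ψ := by
  set t : RatFunc K := RatFunc.X with ht
  let m : (RatFunc K)[X] := X ^ 2 + (C t * X + C (RatFunc.C b * t ^ 2 - RatFunc.C c))
  have hm : m.Monic := monic_X_pow_add (by compute_degree!)
  have hmdeg : m.natDegree = 2 := by
    simp only [m]
    compute_degree!
  have heval : ∀ (N : Type u) [Field N] (ψ : RatFunc K →+* N) (S : N), eval₂ ψ S m =
      S ^ 2 + ψ t * S + ψ (RatFunc.C b) * ψ t ^ 2 - ψ (RatFunc.C c) := by
    intro N _ ψ S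
    simp [m, eval₂_pow]
    ring
  have hirr : Irreducible m := by
    rw [hm.irreducible_iff_roots_eq_zero_of_degree_le_three hmdeg.ge (by omega)]
    refine Multiset.eq_zero_of_forall_notMem fun r hr => ?_
    rw [mem_roots hm.ne_zero, IsRoot.def, ← eval₂_id, heval] at hr
    simp only [RingHom.id_apply] at hr
    have h1 : (2 * r + t) ^ 2 = RatFunc.C (1 - 4 * b) * t ^ 2 + RatFunc.C (4 * c) := by
      simp only [map_sub, map_mul, map_one, map_ofNat]
      linear_combination 4 * hr
    have h2 := RatFunc.sq_mul_ne_C hb hc (one_ne_zero (α := RatFunc K))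
    by_cases h0 : 2 * r + t = 0
    · refine h2 0 ?_
      rw [← ht, ← h1, h0]
      simp
    · refine RatFunc.sq_mul_ne_C hb hc (inv_ne_zero h0) 1 ?_
      rw [← ht, ← h1]
      field_simp
      simp
  have : Fact (Irreducible m) := ⟨hirr⟩
  have hs : AdjoinRoot.root m ^ 2 + AdjoinRoot.of m t * AdjoinRoot.root m
      + AdjoinRoot.of m (RatFunc.C b) * AdjoinRoot.of m t ^ 2 =
      AdjoinRoot.of m (RatFunc.C c) := by
    have h1 := heval _ (AdjoinRoot.of m) (AdjoinRoot.root m)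
    rw [AdjoinRoot.eval₂_root] at h1
    exact (sub_eq_zero.1 h1.symm)
  refine ⟨AdjoinRoot m, inferInstance, AdjoinRoot.of m, AdjoinRoot.root m, hs,
    regularExt_of_quadratic _ hb hc hs fun x => ?_, fun N _ ψ S hS => ?_⟩
  · obtain ⟨P, rfl⟩ := AdjoinRoot.mk_surjective x
    set r := P %ₘ m with hr
    have hrd : r.natDegree < 2 := by
      rw [← hmdeg]
      refine natDegree_modByMonic_lt _ hm ?_
      intro h
      rw [h, natDegree_one] at hmdeg
      omega
    refine ⟨r.coeff 0, r.coeff 1, ?_⟩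
    have h1 : AdjoinRoot.mk m P = AdjoinRoot.mk m r := by
      conv_lhs => rw [← modByMonic_add_div P m]
      simp [hr]
    rw [h1, eq_X_add_C_of_natDegree_le_one (show r.natDegree ≤ 1 by omega)]
    simp [add_comm]
  · exact ⟨AdjoinRoot.lift ψ S (by rw [heval, hS, sub_self]), AdjoinRoot.lift_comp_of _⟩

end Conic

/-- An existential condition which forces `v S ≤ v R` at the `p`-adic valuations at which `g` is
not integral. -/
def ValuationWitness (p : ℕ) (b : ℤ) {R : Type*} [CommRing R] (g r s : R) : Prop :=
  ∃ u : R, s = r * u ∧ IntegralityWitnessAt p b g u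

/-- An existential condition which forces `T` to be an `m`-th power in the `p`-adic closures at
which `g` is not integral. -/
def PowWitness (p : ℕ) (b : ℤ) {R : Type*} [CommRing R] (g : R) (m : ℕ) (T : R) : Prop :=
  ∃ z u : R, T = z ^ m * (1 + p * m ^ 2 * u) ∧ IntegralityWitnessAt p b g u

theorem ValuationWitness.map {p : ℕ} {b : ℤ} {R S : Type*} [CommRing R] [CommRing S]
    (f : R →+* S) {g r s : R} :
    ValuationWitness p b g r s → ValuationWitness p b (f g) (f r) (f s) := by
  rintro ⟨u, rfl, hu⟩
  exact ⟨f u, map_mul f r u, hu.map f⟩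

theorem PowWitness.map {p : ℕ} {b : ℤ} {R S : Type*} [CommRing R] [CommRing S]
    (f : R →+* S) {g : R} {m : ℕ} {T : R} :
    PowWitness p b g m T → PowWitness p b (f g) m (f T) := by
  rintro ⟨z, u, rfl, hu⟩
  exact ⟨f z, f u, by simp, hu.map f⟩

namespace PadicModel

variable {p n : ℕ} {F : Type u} [Field F] {O : Fin n → ValuationSubring F}

open Polynomial in
theorem exists_integralityWitness [CharZero F] (hp : p.Prime) {b : ℤ}
    (hb : ∀ k : ℤ, ¬ (p : ℤ) ∣ k ^ 2 + k + b) (A : PadicModel p n O) (i₀ : Fin n) {h : A.L}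
    (hh : ∀ i, A.lam i h ∈ A.ON i) :
    ∃ (B : PadicModel p n O) (φ : Hom A B), IntegralityWitness p b (φ.f h) := by
  have : CharZero A.L := charZero_of_injective_ringHom A.ι.injective
  have hb1 : (1 - 4 * (b : A.L)) ≠ 0 := by
    have : (1 - 4 * b : ℤ) ≠ 0 := by omega
    exact_mod_cast this
  have hc : (b : A.L) + p * h ^ 2 ≠ 0 := by
    intro h0
    have h1 : ((b : ℤ) : A.N i₀) = p * -(A.lam i₀ h ^ 2) := by
      have := congrArg (A.lam i₀) h0
      simp only [map_add, map_mul, map_pow, map_intCast, map_natCast, map_zero] at this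
      linear_combination this
    have h2 : (A.ON i₀).valuation ((b : ℤ) : A.N i₀) < 1 := by
      rw [h1]
      exact PadicRing.val_mul_lt_one (A.padic i₀).val_lt_one (neg_mem (pow_mem (hh i₀) 2))
    rw [PadicRing.val_int_lt_one_iff hp (A.padic i₀)] at h2
    exact hb 0 (by simpa using h2)
  obtain ⟨E', _, g, s, hs, hreg, hlift⟩ := exists_conic_extension hb1 hc
  obtain ⟨B, φ, z, ⟨e, hφ, hz⟩, hinf⟩ := A.exists_generic (fun _ => 1)
  have hex : ∀ i, ∃ (N2 : Type u) (_ : Field N2) (γ : B.N i →+* N2) (W2 : ValuationSubring N2)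
      (α : N2), PadicRing p W2 ∧ W2.comap γ = B.ON i ∧
      α ^ 2 + γ (B.lam i z) * α + b * γ (B.lam i z) ^ 2 =
        b + p * γ (B.lam i (φ.f h)) ^ 2 := by
    intro i
    have : CharZero (B.N i) := charZero_of_injective_ringHom ((B.lam i).comp B.ι).injective
    have hz1 : (B.ON i).valuation (B.lam i z - 1) < 1 := by
      have := hinf i ((p : A.N i)⁻¹)
      refine (B.padic i).val_lt_one_of_div ?_
      simpa [div_eq_inv_mul] using this
    have hzv : (B.ON i).valuation (B.lam i z) = 1 := by
      have := PadicRing.val_one_add hz1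
      rwa [add_sub_cancel] at this
    let τ : B.ON i := ⟨B.lam i z, ((B.ON i).valuation_le_one_iff _).1 hzv.le⟩
    let η : B.ON i := ⟨B.lam i (φ.f h), by rw [φ.comm_apply, φ.map_mem_iff]; exact hh i⟩
    obtain ⟨c, hc⟩ : ∃ c : B.ON i, c = b * τ ^ 2 - b - p * η ^ 2 := ⟨_, rfl⟩
    have hcv : (c : B.N i) = b * B.lam i z ^ 2 - b - p * B.lam i (φ.f h) ^ 2 := by
      rw [hc]
      rfl
    let f : (B.ON i)[X] := X ^ 2 + (C τ * X + C c)
    have hf : f.Monic := monic_X_pow_add (by compute_degree!)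
    have hf0 : f.eval 0 = c := by simp [f]
    have hf1 : f.derivative.eval 0 = τ := by simp [f]
    have hfa : (B.ON i).valuation ((f.eval 0 : B.ON i) : B.N i) < 1 := by
      rw [hf0]
      have h1 : (c : B.N i) =
          (B.lam i z - 1) * (b * (B.lam i z + 1)) - p * B.lam i (φ.f h) ^ 2 := by
        rw [hcv]
        ring
      rw [h1]
      exact (B.ON i).valuation.map_sub_lt
        (PadicRing.val_mul_lt_one hz1 (mul_mem (intCast_mem _ b) (add_mem τ.2 (one_mem _))))
        (PadicRing.val_mul_lt_one (B.padic i).val_lt_one (pow_mem η.2 2))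
    have hder : (B.ON i).valuation ((f.derivative.eval 0 : B.ON i) : B.N i) = 1 := by
      rw [hf1]
      exact hzv
    obtain ⟨N2, _, γ, W2, α, -, hW2, hcomap, hroot, -⟩ :=
      PadicRing.exists_ext_root hp (B.padic i) hf hfa hder
    refine ⟨N2, inferInstance, γ, W2, α, hW2, hcomap, ?_⟩
    simp only [f, eval₂_add, eval₂_mul, eval₂_X_pow, eval₂_C, eval₂_X] at hroot
    change α ^ 2 + (γ (B.lam i z) * α + γ c) = 0 at hroot
    rw [hcv] at hroot
    simp only [map_sub, map_mul, map_pow, map_intCast, map_natCast] at hroot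
    linear_combination hroot
  choose N2 instN2 γ W2 α hW2 hcomap hα using hex
  have hlam : ∀ i, ∃ ψ' : E' →+* N2 i,
      ψ'.comp g = (γ i).comp ((B.lam i).comp e.toRingHom) := by
    intro i
    refine hlift (N2 i) _ (α i) ?_
    have h1 : ((γ i).comp ((B.lam i).comp e.toRingHom)) RatFunc.X = γ i (B.lam i z) := by
      rw [hz]; rfl
    have h2 : ∀ x, ((γ i).comp ((B.lam i).comp e.toRingHom)) (RatFunc.C x) =
        γ i (B.lam i (φ.f x)) := by
      intro x; rw [hφ]; rfl
    rw [h1, h2, h2]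
    simpa using hα i
  choose lam' hlam' using hlam
  have key : s ^ 2 + s * g RatFunc.X + b * g RatFunc.X ^ 2 =
      b + p * (g (RatFunc.C h)) ^ 2 := by
    simp only [map_add, map_mul, map_pow, map_intCast, map_natCast] at hs
    linear_combination hs
  refine ⟨_, A.toExtend (g.comp RatFunc.C) hreg lam' (fun i => (γ i).comp (φ.g i)) (fun i => ?_)
    W2 hW2 (fun i => by rw [← ValuationSubring.comap_comap, hcomap, φ.comap]), s, g RatFunc.X, key⟩
  rw [← RingHom.comp_assoc, hlam', RingHom.comp_assoc, RingHom.comp_assoc, RingHom.comp_assoc,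
    φ.comm, hφ]

theorem exists_integralityWitnessAt [CharZero F] (hp : p.Prime) {b : ℤ}
    (hb : ∀ k : ℤ, ¬ (p : ℤ) ∣ k ^ 2 + k + b) (A : PadicModel p n O) (i : Fin n) {g : F}
    (hg : ∀ j, j ≠ i → g ∈ O j) {u : A.L} (hu : A.lam i u ∈ A.ON i) :
    ∃ (B : PadicModel p n O) (φ : Hom A B), IntegralityWitnessAt p b (B.ι g) (φ.f u) := by
  classical
  obtain ⟨B, φ, z, -, hinf⟩ := A.exists_generic (fun j => if j = i then 1 else 0)
  have hu' : B.lam i (φ.f u) ∈ B.ON i := by rwa [φ.comm_apply, φ.map_mem_iff]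
  have hz1 : ∀ j, B.lam j z - 1 ∈ B.ON j := by
    intro j
    have := hinf j 1
    by_cases hj : j = i
    · simpa [hj] using this
    · have h1 : B.lam j z ∈ B.ON j := by simpa [hj] using this
      exact sub_mem h1 (one_mem _)
  have hzu : ∀ j, B.lam j (z * φ.f u) ∈ B.ON j := by
    intro j
    rw [map_mul]
    by_cases hj : j = i
    · subst hj
      have h1 : B.lam j z ∈ B.ON j := by
        have := add_mem (hz1 j) (one_mem (B.ON j))
        rwa [sub_add_cancel] at this
      exact mul_mem h1 hu'
    · have := hinf j (A.lam j u)
      simpa [hj, φ.comm_apply, mul_comm] using this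
  have hzg : ∀ j, B.lam j ((z - 1) * B.ι g) ∈ B.ON j := by
    intro j
    by_cases hj : j = i
    · subst hj
      have := hinf j (A.lam j (A.ι g))
      rw [← φ.comm_apply, φ.ι_apply] at this
      simpa [mul_comm] using this
    · rw [map_mul, map_sub, map_one]
      exact mul_mem (hz1 j) ((B.lam_ι_mem_iff j g).2 (hg j hj))
  obtain ⟨B1, φ1, h1⟩ := B.exists_integralityWitness hp hb i hzu
  have hzg' : ∀ j, B1.lam j (φ1.f ((z - 1) * B.ι g)) ∈ B1.ON j := fun j => by
    rw [φ1.comm_apply, φ1.map_mem_iff]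
    exact hzg j
  obtain ⟨B2, φ2, h2⟩ := B1.exists_integralityWitness hp hb i hzg'
  refine ⟨B2, φ.comp (φ1.comp φ2), φ2.f (φ1.f z), ?_, ?_⟩
  · simpa [Hom.comp] using h1.map φ2.f
  · simpa [φ1.ι_apply, φ2.ι_apply] using h2

theorem exists_valuationWitness [CharZero F] (hp : p.Prime) {b : ℤ}
    (hb : ∀ k : ℤ, ¬ (p : ℤ) ∣ k ^ 2 + k + b) (A : PadicModel p n O) (i : Fin n) {g : F}
    (hg : ∀ j, j ≠ i → g ∈ O j) {r s : A.L}
    (hrs : (A.ON i).valuation (A.lam i s) ≤ (A.ON i).valuation (A.lam i r)) :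
    ∃ (B : PadicModel p n O) (φ : Hom A B), ValuationWitness p b (B.ι g) (φ.f r) (φ.f s) := by
  have hu : A.lam i (s / r) ∈ A.ON i := by
    rw [← (A.ON i).valuation_le_one_iff, map_div₀, map_div₀]
    exact div_le_one_of_le₀ hrs zero_le
  obtain ⟨B, φ, h⟩ := A.exists_integralityWitnessAt hp hb i hg hu
  refine ⟨B, φ, φ.f (s / r), ?_, h⟩
  rw [← map_mul]
  congr 1
  by_cases hr : r = 0
  · subst hr
    have : A.lam i s = 0 := by simpa using hrs
    simpa using this
  · field_simp

theorem exists_powWitness [CharZero F] (hp : p.Prime) {b : ℤ}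
    (hb : ∀ k : ℤ, ¬ (p : ℤ) ∣ k ^ 2 + k + b) (A : PadicModel p n O) (i : Fin n) {g : F}
    (hg : ∀ j, j ≠ i → g ∈ O j) {m : ℕ} (hm : 1 ≤ m) {T : A.L}
    (hT : IsNonzeroPow m (A.lam i T)) :
    ∃ (B : PadicModel p n O) (φ : Hom A B), PowWitness p b (B.ι g) m (φ.f T) := by
  classical
  obtain ⟨hT0, y, hy⟩ := hT
  have hy0 : y ≠ 0 := by
    rintro rfl
    rw [zero_pow (by omega)] at hy
    exact hT0 hy
  obtain ⟨B, φ, z, -, hinf⟩ := A.exists_generic (Function.update 0 i y)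
  have : CharZero (A.N i) := charZero_of_injective_ringHom ((A.lam i).comp A.ι).injective
  have : CharZero (B.N i) := charZero_of_injective_ringHom ((B.lam i).comp B.ι).injective
  have : CharZero B.L := charZero_of_injective_ringHom B.ι.injective
  obtain ⟨y', hy'⟩ : ∃ y', y' = φ.g i y := ⟨_, rfl⟩
  have hy'0 : y' ≠ 0 := hy' ▸ (map_ne_zero (φ.g i)).2 hy0
  have hinf' : ∀ c : A.N i, φ.g i c * (B.lam i z - y') ∈ B.ON i := fun c => by
    have := hinf i c
    rwa [Function.update_self, ← hy'] at this
  obtain ⟨δ, hδ⟩ : ∃ δ, δ = (B.lam i z - y') / y' := ⟨_, rfl⟩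
  have hm0 : m ≠ 0 := by omega
  have hδ1 : ∀ k : ℕ, δ / (k : B.N i) ∈ B.ON i := fun k => by
    have := hinf' ((y * k)⁻¹)
    rw [map_inv₀, map_mul, map_natCast, ← hy'] at this
    rwa [hδ, div_div, div_eq_inv_mul]
  have hv : (B.ON i).valuation (1 + δ) = 1 :=
    PadicRing.val_one_add ((B.padic i).val_lt_one_of_div (hδ1 p))
  have hδ0 : 1 + δ ≠ 0 := by intro h; rw [h] at hv; simp at hv
  have hzδ : B.lam i z = y' * (1 + δ) := by rw [hδ]; field_simp; ring
  have hz0 : z ≠ 0 := by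
    rintro rfl
    rw [map_zero, eq_comm] at hzδ
    exact mul_ne_zero hy'0 hδ0 hzδ
  have hTy : B.lam i (φ.f T) = y' ^ m := by rw [φ.comm_apply, hy, map_pow, hy']
  have hu : B.lam i ((φ.f T / z ^ m - 1) / (p * m ^ 2)) ∈ B.ON i := by
    have hgeom := geom_sum_mul (1 + δ) m
    rw [add_sub_cancel_left] at hgeom
    obtain ⟨κ, hκ'⟩ : ∃ κ, κ = ∑ k ∈ Finset.range m, (1 + δ) ^ k := ⟨_, rfl⟩
    rw [← hκ'] at hgeom
    have hδO : 1 + δ ∈ B.ON i := ((B.ON i).valuation_le_one_iff _).1 hv.le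
    have hκ : κ ∈ B.ON i := hκ' ▸ sum_mem fun k _ => pow_mem hδO k
    have h1 : B.lam i ((φ.f T / z ^ m - 1) / (p * m ^ 2)) =
        -(δ / ((p * m ^ 2 : ℕ) : B.N i)) * κ * ((1 + δ)⁻¹) ^ m := by
      rw [map_div₀, map_sub, map_div₀, map_pow, hTy, hzδ, mul_pow, inv_pow]
      simp only [map_mul, map_pow, map_natCast, map_one]
      push_cast
      have hp1 : (p : B.N i) ≠ 0 := Nat.cast_ne_zero.2 hp.ne_zero
      have hm1 : (m : B.N i) ≠ 0 := Nat.cast_ne_zero.2 hm0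
      have : (1 + δ) ^ m ≠ 0 := pow_ne_zero _ hδ0
      have : y' ^ m ≠ 0 := pow_ne_zero _ hy'0
      field_simp
      linear_combination hgeom
    rw [h1]
    exact mul_mem (mul_mem (neg_mem (hδ1 _)) hκ)
      (pow_mem (ValuationSubring.inv_mem_of_valuation_eq_one hv) m)
  obtain ⟨B', φ', h⟩ := B.exists_integralityWitnessAt hp hb i hg hu
  refine ⟨B', φ.comp φ', φ'.f z, φ'.f ((φ.f T / z ^ m - 1) / (p * m ^ 2)), ?_, h⟩
  have h2 : φ.f T = z ^ m * (1 + p * m ^ 2 * ((φ.f T / z ^ m - 1) / (p * m ^ 2))) := by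
    have hp1 : (p : B.L) ≠ 0 := Nat.cast_ne_zero.2 hp.ne_zero
    have hm1 : (m : B.L) ≠ 0 := Nat.cast_ne_zero.2 hm0
    field_simp
    ring
  have h3 := congrArg φ'.f h2
  simp only [map_mul, map_pow, map_add, map_one, map_natCast] at h3
  exact h3

end PadicModel

theorem PadicModel.exists_forall {p n : ℕ} {F : Type u} [Field F] {O : Fin n → ValuationSubring F}
    (A : PadicModel p n O) {T : Type*} [Finite T] (Φ : T → ∀ B : PadicModel p n O, Hom A B → Prop)
    (hcomp : ∀ t B C (φ : Hom A B) (ψ : Hom B C), Φ t B φ → Φ t C (φ.comp ψ))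
    (hex : ∀ t B (φ : Hom A B), ∃ C, ∃ ψ : Hom B C, Φ t C (φ.comp ψ)) :
    ∃ (B : PadicModel p n O) (φ : Hom A B), ∀ t, Φ t B φ := by
  classical
  cases nonempty_fintype T
  suffices h : ∀ s : Finset T, ∃ (B : PadicModel p n O) (φ : Hom A B), ∀ t ∈ s, Φ t B φ by
    simpa using h Finset.univ
  intro s
  induction s using Finset.induction_on with
  | empty => exact ⟨A, Hom.id A, by simp⟩
  | insert a s _ ih =>
    obtain ⟨B, φ, h⟩ := ih
    obtain ⟨C, ψ, hC⟩ := hex a B φ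
    refine ⟨C, φ.comp ψ, fun t ht => ?_⟩
    rcases Finset.mem_insert.1 ht with rfl | ht
    · exact hC
    · exact hcomp t B C φ ψ (h t ht)

/-- Finitely generated algebras inside totally `p`-adic regular extensions of a pseudo
`p`-adically closed field have rational points. -/
theorem IsPpC.exists_ringHom {p : ℕ} {F : Type u} [Field F] (hF : IsPpC p F) {L : Type u} [Field L]
    (f : F →+* L) (htot : TotallyPadicExt p f) (hreg : RegularExt f) {S : Set L} (hS : S.Finite) :
    ∃ (A : Subring L) (j : F →+* A) (φ : A →+* F), S ⊆ A ∧ A.subtype.comp j = f ∧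
      φ.comp j = RingHom.id F := by
  obtain ⟨k, x, -, rfl⟩ := hS.fin_param
  let θ : MvPolynomial (Fin k) F →+* L := MvPolynomial.eval₂Hom f x
  obtain ⟨eqs, heqs⟩ := IsNoetherian.noetherian (RingHom.ker θ)
  obtain ⟨y, hy, -⟩ := hF.2 L f htot hreg k eqs ∅ ⟨x, fun P hP => by
    rw [MvPolynomial.eval_map]
    exact (RingHom.mem_ker (f := θ)).1 (heqs ▸ Ideal.subset_span hP), by simp⟩
  have hker : RingHom.ker θ.rangeRestrict ≤ RingHom.ker (MvPolynomial.eval y) := by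
    rw [RingHom.ker_rangeRestrict, ← heqs]
    exact Ideal.span_le.2 fun P hP => (RingHom.mem_ker).2 (hy P hP)
  refine ⟨θ.range, θ.rangeRestrict.comp MvPolynomial.C,
    θ.rangeRestrict.liftOfSurjective θ.rangeRestrict_surjective ⟨MvPolynomial.eval y, hker⟩,
    ?_, ?_, ?_⟩
  · rintro _ ⟨j, rfl⟩
    exact ⟨MvPolynomial.X j, by simp [θ]⟩
  · ext c
    simp [θ]
  · ext c
    rw [RingHom.comp_apply, RingHom.comp_apply, RingHom.liftOfRightInverse_comp_apply]
    simp

theorem PadicModel.totallyPadicExt {p n : ℕ} (hp : p.Prime) {F : Type u} [Field F]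
    {O : Fin n → ValuationSubring F}
    (hO_all : ∀ O' : ValuationSubring F, IsPadicValRing p O' → ∃ i, O' = O i)
    (B : PadicModel p n O) : TotallyPadicExt p B.ι := by
  intro O' hO'
  obtain ⟨i, rfl⟩ := hO_all O' hO'
  refine ⟨(B.ON i).comap (B.lam i), ((B.padic i).comap (B.lam i)).isPadicValRing hp, ?_⟩
  rw [ValuationSubring.comap_comap, B.comap_eq]

theorem IntegralityWitness.exists_finite {p : ℕ} {b : ℤ} {R : Type*} [CommRing R] {h : R}
    (hh : IntegralityWitness p b h) : ∃ S : Set R, S.Finite ∧ ∀ A : Subring R, S ⊆ A →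
      ∀ h' : A, (h' : R) = h → IntegralityWitness p b h' := by
  obtain ⟨s, t, hst⟩ := hh
  refine ⟨{s, t}, by simp, fun A hA h' hh' => ?_⟩
  simp only [Set.insert_subset_iff, Set.singleton_subset_iff, SetLike.mem_coe] at hA
  refine ⟨⟨s, hA.1⟩, ⟨t, hA.2⟩, Subtype.ext ?_⟩
  simpa [hh'] using hst

theorem IntegralityWitnessAt.exists_finite {p : ℕ} {b : ℤ} {R : Type*} [CommRing R] {g u : R}
    (hu : IntegralityWitnessAt p b g u) : ∃ S : Set R, S.Finite ∧ ∀ A : Subring R, S ⊆ A →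
      ∀ g' u' : A, (g' : R) = g → (u' : R) = u → IntegralityWitnessAt p b g' u' := by
  obtain ⟨z, h1, h2⟩ := hu
  obtain ⟨S1, hS1, h1⟩ := h1.exists_finite
  obtain ⟨S2, hS2, h2⟩ := h2.exists_finite
  refine ⟨insert z (S1 ∪ S2), (hS1.union hS2).insert z, fun A hA g' u' hg hu => ?_⟩
  simp only [Set.insert_subset_iff, Set.union_subset_iff, SetLike.mem_coe] at hA
  exact ⟨⟨z, hA.1⟩, h1 A hA.2.1 _ (by simp [hu]), h2 A hA.2.2 _ (by simp [hg])⟩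

theorem ValuationWitness.exists_finite {p : ℕ} {b : ℤ} {R : Type*} [CommRing R] {g r s : R}
    (h : ValuationWitness p b g r s) : ∃ S : Set R, S.Finite ∧ ∀ A : Subring R, S ⊆ A →
      ∀ g' r' s' : A, (g' : R) = g → (r' : R) = r → (s' : R) = s →
        ValuationWitness p b g' r' s' := by
  obtain ⟨u, rfl, hu⟩ := h
  obtain ⟨S, hS, hu⟩ := hu.exists_finite
  refine ⟨insert u S, hS.insert u, fun A hA g' r' s' hg hr hs => ?_⟩
  simp only [Set.insert_subset_iff, SetLike.mem_coe] at hA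
  exact ⟨⟨u, hA.1⟩, Subtype.ext (by simp [hr, hs]), hu A hA.2 _ _ hg rfl⟩

theorem PowWitness.exists_finite {p : ℕ} {b : ℤ} {R : Type*} [CommRing R] {g : R} {m : ℕ} {T : R}
    (h : PowWitness p b g m T) : ∃ S : Set R, S.Finite ∧ ∀ A : Subring R, S ⊆ A →
      ∀ g' T' : A, (g' : R) = g → (T' : R) = T → PowWitness p b g' m T' := by
  obtain ⟨z, u, rfl, hu⟩ := h
  obtain ⟨S, hS, hu⟩ := hu.exists_finite
  refine ⟨insert z (insert u S), (hS.insert u).insert z, fun A hA g' T' hg hT => ?_⟩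
  simp only [Set.insert_subset_iff, SetLike.mem_coe] at hA
  exact ⟨⟨z, hA.1⟩, ⟨u, hA.2.1⟩, Subtype.ext (by simp [hT]), hu A hA.2.2 _ _ hg rfl⟩

theorem valuation_map_le_of_comap_eq {K K' : Type*} [Field K] [Field K'] {f : K →+* K'}
    {O : ValuationSubring K} {O' : ValuationSubring K'} (h : O'.comap f = O) {r s : K}
    (hrs : O.valuation s ≤ O.valuation r) : O'.valuation (f s) ≤ O'.valuation (f r) := by
  rcases eq_or_ne r 0 with rfl | hr
  · have : s = 0 := by simpa using hrs
    simp [this]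
  have hm : s / r ∈ O := by
    rw [← O.valuation_le_one_iff, map_div₀]
    exact div_le_one_of_le₀ hrs zero_le
  rw [← h, ValuationSubring.mem_comap, ← O'.valuation_le_one_iff, map_div₀, map_div₀] at hm
  refine (div_le_one₀ ?_).1 hm
  simpa [zero_lt_iff] using hr

theorem IsNonzeroPow.map {K K' : Type*} [Field K] [Field K'] (f : K →+* K') {m : ℕ} {x : K} :
    IsNonzeroPow m x → IsNonzeroPow m (f x) := by
  rintro ⟨hx, y, rfl⟩
  exact ⟨(map_ne_zero f).2 hx, f y, map_pow f y m⟩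

/- In the valuation conditions below, recall that Mathlib's `ValuationSubring.valuation`
is multiplicative (`x ∈ O ↔ v x ≤ 1`), so the *additive* condition
`w_i(R(x)) ≤ w_i(S(x))` of the statement is rendered multiplicatively as
`v_i(S(x)) ≤ v_i(R(x))`. -/
theorem stmt10 (p : ℕ) (hp : p.Prime) (n : ℕ)
    (F : Type u) [Field F]
    -- the `p`-adic valuations of `F` are exactly the pairwise distinct `O 1, …, O n`
    (O : Fin n → ValuationSubring F) (hO_inj : Function.Injective O)
    (hO_padic : ∀ i, IsPadicValRing p (O i))
    (hO_all : ∀ O' : ValuationSubring F, IsPadicValRing p O' → ∃ i, O' = O i)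
    (hF : IsPpC p F)
    -- `L` is a totally `p`-adic regular extension of `F`
    (L : Type u) [Field L] (ι : F →+* L)
    (hreg : RegularExt ι) (htot : TotallyPadicExt p ι)
    -- `W i` is a `p`-adic valuation on `L` extending `O i`
    (W : Fin n → ValuationSubring L)
    (hW_padic : ∀ i, IsPadicValRing p (W i))
    (hW_ext : ∀ i, (W i).comap ι = O i)
    -- `N i` is a `p`-adic closure of `(L, W i)`
    (N : Fin n → Type u) [∀ i, Field (N i)]
    (lam : ∀ i, L →+* N i) (ON : ∀ i, ValuationSubring (N i))
    (hN : ∀ i, IsPadicClosure p (lam i) (W i) (ON i))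
    -- `M i` is a `p`-adic closure of `(F, O i)` sitting inside `N i`
    (M : Fin n → Type u) [∀ i, Field (M i)]
    (mu : ∀ i, F →+* M i) (OM : ∀ i, ValuationSubring (M i))
    (hM : ∀ i, IsPadicClosure p (mu i) (O i) (OM i))
    (kap : ∀ i, M i →+* N i)
    (hkap_comm : ∀ i, (kap i).comp (mu i) = (lam i).comp ι)
    (hkap_val : ∀ i, (ON i).comap (kap i) = OM i)
    -- a finite system of conditions on a `k`-tuple of variables
    (k : ℕ) (eqs neqs : Finset (MvPolynomial (Fin k) F))
    (vconds : Fin n → Finset (MvPolynomial (Fin k) F × MvPolynomial (Fin k) F))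
    (pconds : Fin n → Finset (MvPolynomial (Fin k) F × ℕ))
    (hpconds : ∀ i, ∀ Tm ∈ pconds i, 1 ≤ Tm.2)
    -- the system has a solution with coordinates in `L`
    (hsol : ∃ x : Fin k → L,
      (∀ P ∈ eqs, MvPolynomial.eval x (MvPolynomial.map ι P) = 0) ∧
      (∀ Q ∈ neqs, MvPolynomial.eval x (MvPolynomial.map ι Q) ≠ 0) ∧
      (∀ i, ∀ RS ∈ vconds i,
        (W i).valuation (MvPolynomial.eval x (MvPolynomial.map ι RS.2)) ≤
          (W i).valuation (MvPolynomial.eval x (MvPolynomial.map ι RS.1))) ∧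
      (∀ i, ∀ Tm ∈ pconds i,
        IsNonzeroPow Tm.2 ((lam i) (MvPolynomial.eval x (MvPolynomial.map ι Tm.1))))) :
    -- then it has a solution with coordinates in `F`
    ∃ x : Fin k → F,
      (∀ P ∈ eqs, MvPolynomial.eval x P = 0) ∧
      (∀ Q ∈ neqs, MvPolynomial.eval x Q ≠ 0) ∧
      (∀ i, ∀ RS ∈ vconds i,
        (O i).valuation (MvPolynomial.eval x RS.2) ≤
          (O i).valuation (MvPolynomial.eval x RS.1)) ∧
      (∀ i, ∀ Tm ∈ pconds i,
        IsNonzeroPow Tm.2 ((mu i) (MvPolynomial.eval x Tm.1))) := by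
  classical
  have : CharZero F := hF.1
  have : CharZero L := charZero_of_injective_ringHom ι.injective
  have hcN : ∀ i, CharZero (N i) := fun i => charZero_of_injective_ringHom (lam i).injective
  have hcM : ∀ i, CharZero (M i) := fun i => charZero_of_injective_ringHom (mu i).injective
  have hO : ∀ i, PadicRing p (O i) := fun i => .of_isPadicValRing hp (hO_padic i)
  obtain ⟨b, hb⟩ := exists_forall_not_dvd_sq_add_self_add hp
  choose g hg hg' using exists_notMem_forall_mem hp hO_inj hO
  obtain ⟨x, hx, hx0, hxv, hxp⟩ := hsol
  let e : MvPolynomial (Fin k) F →+* L := (MvPolynomial.eval x).comp (MvPolynomial.map ι)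
  let A : PadicModel p n O :=
    { L := L
      ι := ι
      reg := hreg
      N := N
      lam := lam
      ON := ON
      padic := fun i => .of_isPadicValRing hp (hN i).2.2.1
      comap_eq := fun i => by rw [← ValuationSubring.comap_comap, (hN i).2.1, hW_ext] }
  have hv : ∀ i, ∀ RS ∈ vconds i,
      (ON i).valuation (lam i (e RS.2)) ≤ (ON i).valuation (lam i (e RS.1)) := by
    intro i RS hRS
    exact valuation_map_le_of_comap_eq (hN i).2.1 (hxv i RS hRS)
  obtain ⟨B, φ, hB⟩ := A.exists_forall
    (T := (Σ i, vconds i) ⊕ (Σ i, pconds i))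
    (fun t B φ => match t with
      | .inl ⟨i, RS⟩ => ValuationWitness p b (B.ι (g i)) (φ.f (e RS.1.1)) (φ.f (e RS.1.2))
      | .inr ⟨i, Tm⟩ => PowWitness p b (B.ι (g i)) Tm.1.2 (φ.f (e Tm.1.1)))
    (by
      rintro (⟨i, RS⟩ | ⟨i, Tm⟩) B C φ ψ h
      · have := ValuationWitness.map ψ.f h
        rwa [ψ.ι_apply] at this
      · have := PowWitness.map ψ.f h
        rwa [ψ.ι_apply] at this)
    (by
      rintro (⟨i, RS⟩ | ⟨i, Tm⟩) B φ
      · refine B.exists_valuationWitness hp hb i (hg' i) ?_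
        rw [φ.comm_apply, φ.comm_apply]
        exact valuation_map_le_of_comap_eq (φ.comap i) (hv i RS.1 RS.2)
      · refine B.exists_powWitness hp hb i (hg' i) (hpconds i Tm.1 Tm.2) ?_
        rw [φ.comm_apply]
        exact (hxp i Tm.1 Tm.2).map (φ.g i))
  have hS : ∀ t : (Σ i, vconds i) ⊕ (Σ i, pconds i), ∃ S : Set B.L, S.Finite ∧
      ∀ A : Subring B.L, S ⊆ A → match t with
      | .inl ⟨i, RS⟩ => ∀ g' r' s' : A, (g' : B.L) = B.ι (g i) → (r' : B.L) = φ.f (e RS.1.1) →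
          (s' : B.L) = φ.f (e RS.1.2) → ValuationWitness p b g' r' s'
      | .inr ⟨i, Tm⟩ => ∀ g' T' : A, (g' : B.L) = B.ι (g i) → (T' : B.L) = φ.f (e Tm.1.1) →
          PowWitness p b g' Tm.1.2 T' := by
    rintro (⟨i, RS⟩ | ⟨i, Tm⟩)
    · exact ValuationWitness.exists_finite (hB (.inl ⟨i, RS⟩))
    · exact PowWitness.exists_finite (hB (.inr ⟨i, Tm⟩))
  choose S hSfin hS using hS
  let Z : Finset (MvPolynomial (Fin k) F) :=
    neqs ∪ Finset.univ.biUnion fun i => (pconds i).image Prod.fst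
  have hZ : ∀ Q ∈ Z, e Q ≠ 0 := by
    intro Q hQ
    simp only [Z, Finset.mem_union, Finset.mem_biUnion, Finset.mem_image, Finset.mem_univ,
      true_and] at hQ
    rcases hQ with hQ | ⟨i, Tm, hTm, rfl⟩
    · exact hx0 Q hQ
    · intro h0
      refine (hxp i Tm hTm).1 ?_
      change lam i (e Tm.1) = 0
      rw [h0, map_zero]
  obtain ⟨R, j, ψ, hR, hj, hψ⟩ := hF.exists_ringHom B.ι (B.totallyPadicExt hp hO_all) B.reg
    (S := (Set.range fun a => φ.f (x a)) ∪ ((fun Q => (φ.f (e Q))⁻¹) '' Z) ∪ ⋃ t, S t)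
    (((Set.finite_range _).union (Z.finite_toSet.image _)).union (Set.finite_iUnion hSfin))
  simp only [Set.union_subset_iff, Set.iUnion_subset_iff] at hR
  obtain ⟨⟨hRx, hRZ⟩, hRS⟩ := hR
  let y : Fin k → R := fun a => ⟨φ.f (x a), hRx ⟨a, rfl⟩⟩
  let θ : MvPolynomial (Fin k) F →+* R := MvPolynomial.eval₂Hom j y
  have hjc : ∀ c, ((j c : R) : B.L) = B.ι c := RingHom.congr_fun hj
  have hψc : ∀ c, ψ (j c) = c := RingHom.congr_fun hψ
  have hθ : ∀ P, ((θ P : R) : B.L) = φ.f (e P) := by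
    refine RingHom.congr_fun (f := R.subtype.comp θ) (g := φ.f.comp e)
      (MvPolynomial.ringHom_ext (fun c => ?_) fun a => ?_)
    · simpa [θ, e, hjc] using (φ.ι_apply c).symm
    · simp [θ, e, y]
  have hψθ : ∀ P, ψ (θ P) = MvPolynomial.eval (fun a => ψ (y a)) P := by
    refine RingHom.congr_fun (f := ψ.comp θ)
      (MvPolynomial.ringHom_ext (fun c => ?_) fun a => ?_)
    · simp [θ, hψc]
    · simp [θ]
  have hne : ∀ Q ∈ Z, MvPolynomial.eval (fun a => ψ (y a)) Q ≠ 0 := by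
    intro Q hQ
    have h1 : θ Q * ⟨(φ.f (e Q))⁻¹, hRZ ⟨Q, hQ, rfl⟩⟩ = 1 :=
      Subtype.ext (by simp [hθ, hZ Q hQ])
    rw [← hψθ]
    exact left_ne_zero_of_mul_eq_one (by rw [← map_mul, h1, map_one])
  refine ⟨fun a => ψ (y a), fun P hP => ?_, fun Q hQ => hne Q ?_, fun i RS hRS' => ?_,
    fun i Tm hTm => ⟨?_, ?_⟩⟩
  · have h1 : θ P = 0 := Subtype.ext (by
      rw [hθ, show e P = 0 from hx P hP, map_zero]
      rfl)
    rw [← hψθ, h1, map_zero]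
  · exact Finset.mem_union_left _ hQ
  · have h1 := (hS (.inl ⟨i, RS, hRS'⟩) R (hRS _) (j (g i)) _ _ (hjc _) (hθ _) (hθ _)).map ψ
    rw [hψc, hψθ, hψθ] at h1
    obtain ⟨u, hu, hu'⟩ := h1
    rw [hu, map_mul]
    exact mul_le_of_le_one_right' (((O i).valuation_le_one_iff u).2 (hu'.mem hp (hO i) hb (hg i)))
  · rw [_root_.map_ne_zero]
    refine hne _ (Finset.mem_union_right _ ?_)
    simp only [Finset.mem_biUnion, Finset.mem_image, Finset.mem_univ, true_and]
    exact ⟨i, Tm, hTm, rfl⟩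
  · have h1 := (hS (.inr ⟨i, Tm, hTm⟩) R (hRS _) (j (g i)) _ (hjc _) (hθ _)).map ψ
    rw [hψc, hψθ] at h1
    obtain ⟨z, u, hu, hu'⟩ := h1
    have hu1 : mu i u ∈ OM i := by
      have := hu'.mem hp (hO i) hb (hg i)
      rwa [← (hM i).2.1] at this
    obtain ⟨w, hw⟩ := exists_pow_eq_of_mem hp (hM i).2.2 (hpconds i Tm hTm) hu1
    refine ⟨mu i z * w, ?_⟩
    rw [hu, mul_pow, ← hw]
    simp
end

section
/- Let F be a field of characteristic 0 with algebraic closure Ω, and assume F is bounded: for every integer n ≥ 1, F has only finitely many field extensions of degree n inside Ω. Let F₀ be an elementary substructure of F in the first-order language of rings. Then Ω = alg(F₀)·F, i.e. the compositum inside Ω of F with the relative algebraic closure of F₀ in Ω is all of Ω. -/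
open FirstOrder

/-- The relative algebraic closure of a subfield `E` inside `Ω`: the subfield of all
elements of `Ω` that are algebraic (equivalently, integral) over `E`. -/
def algClo {Ω : Type*} [Field Ω] (E : Subfield Ω) : Subfield Ω where
  carrier := {x : Ω | IsIntegral E x}
  mul_mem' := fun ha hb => ha.mul hb
  one_mem' := isIntegral_one
  add_mem' := fun ha hb => ha.add hb
  zero_mem' := isIntegral_zero
  neg_mem' := fun ha => ha.neg
  inv_mem' := fun _ hx => hx.inv

open Polynomial in
/-- The polynomial `∑ aᵢ Xⁱ` of degree less than `n` with prescribed coefficients. -/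
noncomputable def polyOfCoeffs {R : Type*} [CommRing R] {n : ℕ} (a : Fin n → R) : R[X] :=
  ∑ i : Fin n, C (a i) * X ^ (i : ℕ)

namespace polyOfCoeffs

open Polynomial

variable {R S : Type*} [CommRing R] [CommRing S] {n : ℕ}

theorem map (φ : R →+* S) (a : Fin n → R) :
    (polyOfCoeffs a).map φ = polyOfCoeffs (fun i => φ (a i)) := by
  simp [polyOfCoeffs, Polynomial.map_sum]

theorem monic_X_pow_add (a : Fin n → R) : (X ^ n + polyOfCoeffs a).Monic :=
  Polynomial.monic_X_pow_add (degree_sum_fin_lt a)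

theorem natDegree_X_pow_add [Nontrivial R] (a : Fin n → R) :
    (X ^ n + polyOfCoeffs a).natDegree = n := by
  have h : (polyOfCoeffs a).degree < (X ^ n : R[X]).degree := by
    rw [degree_X_pow]; exact degree_sum_fin_lt a
  rw [natDegree_add_eq_left_of_degree_lt h, natDegree_X_pow]

theorem exists_eq_of_degree_lt {p : R[X]} (hp : p.degree < n) :
    ∃ a : Fin n → R, polyOfCoeffs a = p := by
  refine ⟨fun i => p.coeff i, ?_⟩
  rw [polyOfCoeffs, Fin.sum_univ_eq_sum_range (fun i => C (p.coeff i) * X ^ i)]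
  ext k
  simp only [finsetSum_coeff, coeff_C_mul_X_pow]
  rw [Finset.sum_ite_eq]
  split_ifs with h
  · rfl
  · exact (coeff_eq_zero_of_degree_lt (hp.trans_le (by simpa using h))).symm

theorem exists_X_pow_add_eq {p : R[X]} (hp : p.Monic) (hn : p.natDegree = n) :
    ∃ a : Fin n → R, X ^ n + polyOfCoeffs a = p := by
  subst hn
  refine ⟨fun i => p.coeff i, ?_⟩
  rw [polyOfCoeffs, Fin.sum_univ_eq_sum_range (fun i => C (p.coeff i) * X ^ i)]
  exact hp.as_sum.symm

end polyOfCoeffs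

section Formula

open Polynomial FirstOrder Language

/-- The remainder of `g ∘ h` modulo `f`, where `f = X ^ N + ∑ cᵢ Xⁱ`, `g = X ^ n + ∑ dᵢ Xⁱ`
and `h = ∑ eᵢ Xⁱ`. -/
noncomputable def compRemainder {R : Type*} [CommRing R] {n N : ℕ} (c : Fin N → R)
    (d : Fin n → R) (e : Fin N → R) : R[X] :=
  ((X ^ n + polyOfCoeffs d).comp (polyOfCoeffs e)) %ₘ (X ^ N + polyOfCoeffs c)

theorem compRemainder_map {R S : Type*} [CommRing R] [CommRing S] (φ : R →+* S) {n N : ℕ}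
    (c : Fin N → R) (d : Fin n → R) (e : Fin N → R) :
    (compRemainder c d e).map φ =
      compRemainder (fun i => φ (c i)) (fun i => φ (d i)) (fun i => φ (e i)) := by
  simp [compRemainder, Polynomial.map_modByMonic _ (polyOfCoeffs.monic_X_pow_add c),
    Polynomial.map_comp, polyOfCoeffs.map]

/-- The formula expressing that a polynomial whose coefficients are integral polynomial
expressions in the variables is zero. -/
noncomputable def polyEqZeroFormula {α : Type*} (p : (FreeCommRing α)[X]) :
    Language.ring.Formula α :=
  Formula.iInf fun i : Fin (p.natDegree + 1) =>
    (Ring.termOfFreeCommRing (p.coeff i)).equal (Ring.termOfFreeCommRing 0)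

theorem realize_polyEqZeroFormula {α K : Type*} [CommRing K] [Ring.CompatibleRing K]
    (p : (FreeCommRing α)[X]) (v : α → K) :
    (polyEqZeroFormula p).Realize v ↔ p.map (FreeCommRing.lift v) = 0 := by
  simp only [polyEqZeroFormula, Formula.realize_iInf, Formula.realize_equal,
    Ring.realize_termOfFreeCommRing, map_zero]
  constructor
  · intro h
    ext i
    rw [coeff_map, coeff_zero]
    by_cases hi : i < p.natDegree + 1
    · exact h ⟨i, hi⟩
    · rw [coeff_eq_zero_of_natDegree_lt (by omega), map_zero]
  · intro h i
    rw [← coeff_map, h, coeff_zero]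

/-- The formula in `c` expressing that for every monic `g` of degree `n` there is `h` of degree
less than `N` such that `X ^ N + ∑ cᵢ Xⁱ` divides `g ∘ h`. -/
noncomputable def dvdCompFormula (n N : ℕ) : Language.ring.Formula (Fin N) :=
  ((polyEqZeroFormula (α := (Fin N ⊕ Fin n) ⊕ Fin N) (compRemainder
    (fun i => FreeCommRing.of (.inl (.inl i))) (fun i => FreeCommRing.of (.inl (.inr i)))
    (fun i => FreeCommRing.of (.inr i)))).iExs (Fin N)).iAlls (Fin n)

theorem realize_dvdCompFormula {K : Type*} [CommRing K] [Ring.CompatibleRing K] (n N : ℕ)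
    (c : Fin N → K) :
    (dvdCompFormula n N).Realize c ↔
      ∀ d : Fin n → K, ∃ e : Fin N → K,
        X ^ N + polyOfCoeffs c ∣ (X ^ n + polyOfCoeffs d).comp (polyOfCoeffs e) := by
  simp only [dvdCompFormula, Formula.realize_iAlls, Formula.realize_iExs,
    realize_polyEqZeroFormula, compRemainder_map, FreeCommRing.lift_of, Sum.elim_inl,
    Sum.elim_inr]
  simp only [compRemainder, modByMonic_eq_zero_iff_dvd (polyOfCoeffs.monic_X_pow_add c)]

/-- The sentence asserting that `dvdCompFormula n N` is satisfied by some tuple. -/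
noncomputable def existsDvdCompFormula (n N : ℕ) : Language.ring.Formula (Fin 0) :=
  ((dvdCompFormula n N).relabel (Sum.inr : Fin N → Fin 0 ⊕ Fin N)).iExs (Fin N)

theorem realize_existsDvdCompFormula {K : Type*} [CommRing K] [Ring.CompatibleRing K] (n N : ℕ)
    (a : Fin 0 → K) :
    (existsDvdCompFormula n N).Realize a ↔ ∃ c : Fin N → K, (dvdCompFormula n N).Realize c := by
  simp [existsDvdCompFormula]

end Formula

section Bounded

open Polynomial IntermediateField

variable {K L : Type*} [Field K] [Field L] [Algebra K L]

theorem exists_forall_eq_aeval_of_finite [CharZero K] [Algebra.IsAlgebraic K L] (n : ℕ)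
    (hfin : {E : IntermediateField K L | 1 ≤ Module.finrank K E ∧ Module.finrank K E ≤ n}.Finite) :
    ∃ α : L, ∀ β : L, (minpoly K β).natDegree ≤ n → ∃ h : K[X], aeval α h = β := by
  set S := {E : IntermediateField K L | 1 ≤ Module.finrank K E ∧ Module.finrank K E ≤ n}
  have : Finite S := hfin
  have (E : S) : FiniteDimensional K E.1 := Module.finite_of_finrank_pos E.2.1
  set M : IntermediateField K L := ⨆ E : S, E.1
  have : FiniteDimensional K M := finiteDimensional_iSup_of_finite
  obtain ⟨α, hα⟩ := Field.exists_primitive_element K M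
  refine ⟨α, fun β hβ => ?_⟩
  have hint : IsIntegral K β := Algebra.IsIntegral.isIntegral β
  have hS : K⟮β⟯ ∈ S := by
    constructor <;> rw [adjoin.finrank hint]
    · exact minpoly.natDegree_pos hint
    · exact hβ
  have hβM : β ∈ M := le_iSup (fun E : S => E.1) ⟨_, hS⟩ (mem_adjoin_simple_self K β)
  have hmem : (⟨β, hβM⟩ : M) ∈ K⟮α⟯.toSubalgebra := by rw [hα]; exact mem_top
  rw [adjoin_simple_toSubalgebra_of_isAlgebraic (Algebra.IsAlgebraic.isAlgebraic α),
    Algebra.adjoin_singleton_eq_range_aeval] at hmem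
  obtain ⟨h, hh⟩ := hmem
  refine ⟨h, ?_⟩
  calc aeval (algebraMap M L α) h = algebraMap M L (aeval α h) := aeval_algebraMap_apply L α h
    _ = β := congrArg (algebraMap M L) hh

/-- If there are only finitely many extensions of degree at most `n`, then a single monic
polynomial `f` of positive degree divides some `g ∘ h` for each monic `g` of degree `n`. -/
theorem exists_dvd_comp_of_finite [CharZero K] [IsAlgClosed L] [Algebra.IsAlgebraic K L]
    {n : ℕ} (hn : n ≠ 0)
    (hfin : {E : IntermediateField K L | 1 ≤ Module.finrank K E ∧ Module.finrank K E ≤ n}.Finite) :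
    ∃ N : ℕ, N ≠ 0 ∧ ∃ c : Fin N → K, ∀ d : Fin n → K, ∃ e : Fin N → K,
      X ^ N + polyOfCoeffs c ∣ (X ^ n + polyOfCoeffs d).comp (polyOfCoeffs e) := by
  obtain ⟨α, hα⟩ := exists_forall_eq_aeval_of_finite n hfin
  have hint : IsIntegral K α := Algebra.IsIntegral.isIntegral α
  obtain ⟨c, hc⟩ := polyOfCoeffs.exists_X_pow_add_eq (minpoly.monic hint) rfl
  refine ⟨_, (minpoly.natDegree_pos hint).ne', c, fun d => ?_⟩
  set g : K[X] := X ^ n + polyOfCoeffs d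
  have hg : g.Monic := polyOfCoeffs.monic_X_pow_add d
  have hgn : g.natDegree = n := polyOfCoeffs.natDegree_X_pow_add d
  obtain ⟨β, hβ⟩ := IsAlgClosed.exists_aeval_eq_zero L g
    (by rw [degree_eq_natDegree hg.ne_zero, hgn]; exact_mod_cast hn)
  obtain ⟨h, hh⟩ := hα β
    (hgn ▸ natDegree_le_of_dvd (minpoly.dvd K β hβ) hg.ne_zero)
  obtain ⟨e, he⟩ := polyOfCoeffs.exists_eq_of_degree_lt (n := (minpoly K α).natDegree)
    (p := h %ₘ minpoly K α)
    (by
      rw [← degree_eq_natDegree (minpoly.ne_zero hint)]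
      exact degree_modByMonic_lt _ (minpoly.monic hint))
  refine ⟨e, ?_⟩
  rw [hc, he]
  apply minpoly.dvd
  rw [aeval_comp, aeval_modByMonic_eq_self_of_root (minpoly.aeval K α), hh, hβ]

/-- If `f` is not a nonzero constant and divides `g ∘ h`, with `g` the minimal polynomial of `β`,
then `β = h(α)` for some root `α` of `f`. -/
theorem exists_root_aeval_eq_of_dvd_comp [IsAlgClosed L] [Algebra.IsAlgebraic K L]
    {f h : K[X]} {β : L} (hf : f.degree ≠ 0) (hdvd : f ∣ (minpoly K β).comp h) :
    ∃ α : L, aeval α f = 0 ∧ aeval α h = β := by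
  have : IsAlgClosure K L := ⟨inferInstance, inferInstance⟩
  obtain ⟨α, hα⟩ := IsAlgClosed.exists_aeval_eq_zero L f hf
  have hroot : aeval (aeval α h) (minpoly K β) = 0 := by
    rw [← aeval_comp]
    exact aeval_eq_zero_of_dvd_aeval_eq_zero hdvd hα
  obtain ⟨σ, hσ⟩ := minpoly.exists_algEquiv_of_root (Algebra.IsAlgebraic.isAlgebraic β) hroot
  refine ⟨σ α, ?_, ?_⟩
  · rw [aeval_algHom_apply, hα, map_zero]
  · rw [aeval_algHom_apply, hσ]

end Bounded

theorem finite_intermediateField_of_finite_subfield {Ω : Type*} [Field Ω] (F : Subfield Ω)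
    (hbdd : ∀ n : ℕ, 1 ≤ n →
      {E : Subfield Ω | ∃ h : F ≤ E,
        letI := (Subfield.inclusion h).toAlgebra
        Module.finrank F E = n}.Finite) (n : ℕ) :
    {E : IntermediateField F Ω |
      1 ≤ Module.finrank F E ∧ Module.finrank F E ≤ n}.Finite := by
  refine Set.Finite.of_finite_image (f := IntermediateField.toSubfield) ?_
    (fun _ _ _ _ h => IntermediateField.toSubfield_injective h)
  refine ((Set.finite_Icc 1 n).biUnion fun k hk => hbdd k hk.1).subset ?_
  rintro _ ⟨E, hE, rfl⟩
  refine Set.mem_biUnion (x := Module.finrank F E) hE ?_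
  refine ⟨fun x hx => E.algebraMap_mem ⟨x, hx⟩, ?_⟩
  rfl

theorem stmt11 {Ω : Type*} [Field Ω] [IsAlgClosed Ω] [CharZero Ω]
    (F : Subfield Ω)
    -- `Ω` is an algebraic closure of `F`: every element of `Ω` is algebraic over `F`
    (halg : ∀ x : Ω, IsIntegral F x)
    -- `F` is bounded: finitely many extensions of each finite degree `n ≥ 1` inside `Ω`
    (hbdd : ∀ n : ℕ, 1 ≤ n →
      {E : Subfield Ω | ∃ h : F ≤ E,
        letI := (Subfield.inclusion h).toAlgebra
        Module.finrank F E = n}.Finite)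
    (F₀ : Subfield Ω) (hF₀F : F₀ ≤ F)
    -- `F₀` is an elementary substructure of `F` in the first-order language of rings
    (helem : ∀ (k : ℕ) (φ : Language.ring.Formula (Fin k)) (a : Fin k → F₀),
      (letI := Ring.compatibleRingOfRing (↥F₀); φ.Realize a) ↔
      (letI := Ring.compatibleRingOfRing (↥F);
        φ.Realize (fun i => Subfield.inclusion hF₀F (a i)))) :
    algClo F₀ ⊔ F = (⊤ : Subfield Ω) := by
  have : Algebra.IsAlgebraic F Ω := ⟨fun x => (halg x).isAlgebraic⟩
  refine eq_top_iff.mpr fun β _ => ?_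
  set n := (minpoly F β).natDegree
  obtain ⟨N, hN, hc⟩ := exists_dvd_comp_of_finite (L := Ω) (minpoly.natDegree_pos (halg β)).ne'
    (finite_intermediateField_of_finite_subfield F hbdd n)
  obtain ⟨c, hc⟩ : ∃ c : Fin N → F₀, letI := Ring.compatibleRingOfRing (↥F₀)
      (dvdCompFormula n N).Realize c := by
    let := Ring.compatibleRingOfRing (↥F₀)
    rw [← realize_existsDvdCompFormula n N Fin.elim0]
    refine (helem 0 _ _).mpr ?_
    let := Ring.compatibleRingOfRing (↥F)
    simp only [realize_existsDvdCompFormula, realize_dvdCompFormula]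
    exact hc
  have hcF := (helem N _ c).mp hc
  let := Ring.compatibleRingOfRing (↥F)
  rw [realize_dvdCompFormula] at hcF
  obtain ⟨d, hd⟩ := polyOfCoeffs.exists_X_pow_add_eq (minpoly.monic (halg β)) rfl
  obtain ⟨e, he⟩ := hcF d
  rw [hd] at he
  obtain ⟨α, hα, rfl⟩ := exists_root_aeval_eq_of_dvd_comp
    (by
      rw [Polynomial.degree_eq_natDegree (polyOfCoeffs.monic_X_pow_add _).ne_zero,
        polyOfCoeffs.natDegree_X_pow_add]
      exact_mod_cast hN) he
  have hα₀ : α ∈ algClo F₀ := by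
    refine ⟨Polynomial.X ^ N + polyOfCoeffs c, polyOfCoeffs.monic_X_pow_add c, ?_⟩
    simp only [polyOfCoeffs, map_add, map_sum, map_mul, map_pow, Polynomial.aeval_X,
      Polynomial.aeval_C] at hα
    simp only [polyOfCoeffs, Polynomial.eval₂_add, Polynomial.eval₂_finsetSum,
      Polynomial.eval₂_mul, Polynomial.eval₂_X_pow, Polynomial.eval₂_C]
    exact hα
  rw [polyOfCoeffs, map_sum]
  refine sum_mem fun i _ => ?_
  rw [map_mul, Polynomial.aeval_C, map_pow, Polynomial.aeval_X]
  exact mul_mem (le_sup_right (a := algClo F₀) (e i).2) (pow_mem (le_sup_left (b := F) hα₀) _)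
end
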